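/- arXiv:1507.01307 — 12 statements merged into one kernel-verified Lean document; each statement's English description precedes it below -/
import Mathlib

section
/- Suppose the dictionary A = A0 ∪ Ac satisfies the principal recovery condition (PRC): γ0 < s(Ac, S0), where γ0 is the covering radius of ±A0. Then for every b ∈ S0, every optimal solution of Basis Pursuit is subspace-sparse: if x ∈ ℝ^J satisfies Σ_j x_j a_j = b and ‖x‖₁ = p(A, b), then x_j = 0 for all j ∈ Jc. -/
open scoped RealInnerProductSpace ENNReal

noncomputable section

/-- If the vectors `a j` of a subspace `S` satisfy `c ‖w‖ ≤ max_j |⟪a j, w⟫|` on `S`, then every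
`v ∈ S` is a combination of them whose coefficients have `ℓ¹` norm at most `‖v‖ / c`. -/
theorem exists_sum_smul_eq_of_exists_le_abs_inner {E ι : Type*} [NormedAddCommGroup E]
    [InnerProductSpace ℝ E] [FiniteDimensional ℝ E] [Fintype ι] (a : ι → E)
    (S : Submodule ℝ E) (ha : ∀ j, a j ∈ S) {c : ℝ} (hc : 0 < c)
    (h : ∀ w ∈ S, ∃ j, c * ‖w‖ ≤ |⟪a j, w⟫|) {v : E} (hv : v ∈ S) :
    ∃ y : ι → ℝ, ∑ j, y j • a j = v ∧ c * ∑ j, |y j| ≤ ‖v‖ := by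
  classical
  set R : ℝ := ‖v‖ / c with hR
  have hR0 : 0 ≤ R := by positivity
  have hcR : c * R = ‖v‖ := by rw [hR]; field_simp
  set K : Set (ι → ℝ) := {y | ∑ j, |y j| ≤ R} with hK
  set L : (ι → ℝ) →ₗ[ℝ] E := Fintype.linearCombination ℝ a with hL
  have hLy : ∀ y, L y = ∑ j, y j • a j := fun y => Fintype.linearCombination_apply ℝ a y
  by_cases hmem : v ∈ L '' K
  · obtain ⟨y, hy, rfl⟩ := hmem
    refine ⟨y, (hLy y).symm, ?_⟩
    rw [← hcR]
    exact mul_le_mul_of_nonneg_left hy hc.le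
  exfalso
  have hKconv : Convex ℝ K := by
    intro y hy z hz s t hs ht hst
    calc ∑ j, |(s • y + t • z) j| ≤ ∑ j, (s * |y j| + t * |z j|) := by
          refine Finset.sum_le_sum fun j _ => ?_
          simp only [Pi.add_apply, Pi.smul_apply, smul_eq_mul]
          refine (abs_add_le _ _).trans ?_
          rw [abs_mul, abs_mul, abs_of_nonneg hs, abs_of_nonneg ht]
      _ = s * ∑ j, |y j| + t * ∑ j, |z j| := by
          rw [Finset.sum_add_distrib, Finset.mul_sum, Finset.mul_sum]
      _ ≤ s * R + t * R :=
          add_le_add (mul_le_mul_of_nonneg_left hy hs) (mul_le_mul_of_nonneg_left hz ht)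
      _ = R := by rw [← add_mul, hst, one_mul]
  have hKcomp : IsCompact K := by
    refine (isCompact_univ_pi fun _ : ι => isCompact_Icc (a := -R) (b := R)).of_isClosed_subset
      (isClosed_le (by fun_prop) continuous_const) fun y hy j _ => abs_le.1 ?_
    exact (Finset.single_le_sum (f := fun j => |y j|) (fun _ _ => abs_nonneg _)
      (Finset.mem_univ j)).trans hy
  have hclosed : IsClosed (L '' K) :=
    (hKcomp.image (LinearMap.continuous_of_finiteDimensional L)).isClosed
  obtain ⟨f, u, hfu, huv⟩ :=
    geometric_hahn_banach_closed_point (hKconv.linear_image L) hclosed hmem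
  set w : E := S.starProjection ((InnerProductSpace.toDual ℝ E).symm f) with hw
  have hwS : w ∈ S := Submodule.starProjection_apply_mem _ _
  have hfw : ∀ s ∈ S, f s = ⟪s, w⟫ := by
    intro s hs
    rw [hw, ← Submodule.inner_starProjection_left_eq_right,
      Submodule.starProjection_eq_self_iff.2 hs, real_inner_comm,
      InnerProductSpace.toDual_symm_apply]
  obtain ⟨j, hj⟩ := h w hwS
  have hsingle : ∀ t : ℝ, |t| ≤ R → t * ⟪a j, w⟫ < f v := by
    intro t ht
    have hL' : L (Pi.single j t) = t • a j := by
      simp [hL]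
    have hmemK : Pi.single j t ∈ K := by
      change ∑ i, |(Pi.single j t : ι → ℝ) i| ≤ R
      rw [Finset.sum_eq_single j (fun i _ hi => by simp [Pi.single_eq_of_ne hi]) (by simp)]
      simpa using ht
    have := (hfu _ ⟨_, hmemK, rfl⟩).trans huv
    rwa [hL', map_smul, smul_eq_mul, hfw _ (ha j)] at this
  have hlt : R * |⟪a j, w⟫| < f v := by
    rcases abs_choice ⟪a j, w⟫ with h' | h' <;> rw [h']
    · exact hsingle R (abs_of_nonneg hR0).le
    · have := hsingle (-R) (by rw [abs_neg, abs_of_nonneg hR0])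
      linarith
  have hle : f v ≤ ‖v‖ * ‖w‖ := hfw v hv ▸ real_inner_le_norm v w
  have := mul_le_mul_of_nonneg_left hj hR0
  rw [← hcR] at hle
  linarith

/-- If no direction of `S` has spherical distance more than `γ < π / 2` to all of the lines spanned
by the unit vectors `a j`, then each `w ∈ S` satisfies `cos γ ‖w‖ ≤ |⟪a j, w⟫|` for some `j`. -/
theorem exists_cos_mul_norm_le_abs_inner {E ι : Type*} [NormedAddCommGroup E]
    [InnerProductSpace ℝ E] [Finite ι] [Nonempty ι] (a : ι → E) (ha : ∀ j, ‖a j‖ = 1)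
    (S : Submodule ℝ E) {γ : ℝ} (hγ : γ ≤ Real.pi)
    (h : ∀ w ∈ S, ‖w‖ = 1 → ⨅ j, Real.arccos |⟪a j, w⟫| ≤ γ) {w : E} (hw : w ∈ S) :
    ∃ j, Real.cos γ * ‖w‖ ≤ |⟪a j, w⟫| := by
  rcases eq_or_ne w 0 with rfl | hw0
  · exact ⟨Classical.arbitrary ι, by simp⟩
  have hpos : 0 < ‖w‖ := norm_pos_iff.2 hw0
  have hunit : ‖‖w‖⁻¹ • w‖ = 1 := by
    rw [norm_smul, norm_inv, norm_norm, inv_mul_cancel₀ hpos.ne']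
  obtain ⟨j, hj⟩ := exists_eq_ciInf_of_finite (f := fun j => Real.arccos |⟪a j, ‖w‖⁻¹ • w⟫|)
  refine ⟨j, ?_⟩
  have hcos := Real.cos_le_cos_of_nonneg_of_le_pi (Real.arccos_nonneg _) hγ
    (hj.trans_le (h _ (S.smul_mem _ hw) hunit))
  have hone : |⟪a j, ‖w‖⁻¹ • w⟫| ≤ 1 := by
    simpa [ha j, hunit] using abs_real_inner_le_norm (a j) (‖w‖⁻¹ • w)
  rw [Real.cos_arccos (by linarith [abs_nonneg ⟪a j, ‖w‖⁻¹ • w⟫]) hone, real_inner_smul_right,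
    abs_mul, abs_of_pos (inv_pos.2 hpos), inv_mul_eq_div, le_div_iff₀ hpos] at hcos
  exact hcos

/-- If `γ ≥ 0` is less than the spherical distance from a unit vector to `v` and to `-v`, then
`γ < π / 2` and the inner product with `v` is less than `cos γ ‖v‖` in absolute value. -/
theorem lt_pi_div_two_and_abs_inner_lt_of_lt_arccos {E : Type*} [NormedAddCommGroup E]
    [InnerProductSpace ℝ E] {a v : E} (ha : ‖a‖ = 1) (hv : v ≠ 0) {γ : ℝ} (hγ : 0 ≤ γ)
    (hpos : γ < Real.arccos (⟪a, v⟫ / (‖a‖ * ‖v‖)))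
    (hneg : γ < Real.arccos (⟪a, -v⟫ / (‖a‖ * ‖-v‖))) :
    γ < Real.pi / 2 ∧ |⟪a, v⟫| < Real.cos γ * ‖v‖ := by
  have hv' : 0 < ‖v‖ := norm_pos_iff.2 hv
  rw [ha, one_mul] at hpos hneg
  rw [inner_neg_right, norm_neg, neg_div] at hneg
  have habs : |⟪a, v⟫ / ‖v‖| ≤ 1 := by
    simpa [ha] using abs_real_inner_div_norm_mul_norm_le_one a v
  obtain ⟨h₁, h₂⟩ := abs_le.1 habs
  have hcos := Real.cos_lt_cos_of_nonneg_of_le_pi hγ (Real.arccos_le_pi _) hpos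
  have hcos' := Real.cos_lt_cos_of_nonneg_of_le_pi hγ (Real.arccos_le_pi _) hneg
  rw [Real.cos_arccos h₁ h₂, div_lt_iff₀ hv'] at hcos
  rw [Real.cos_arccos (by linarith) (by linarith), ← neg_div, div_lt_iff₀ hv'] at hcos'
  rw [Real.arccos_neg] at hneg
  exact ⟨by linarith, abs_lt.2 ⟨by linarith, hcos⟩⟩

/-- If a dictionary `A = A0 ∪ Ac` of unit vectors (with `A0 = (a0 j)` spanning
`S0` and every atom `ac j` outside `S0`) satisfies the principal recovery condition (PRC)
`γ0 < s(Ac, S0)`, where `γ0` is the covering radius of `±A0` and `s(Ac, S0)` is the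
infimum of the spherical distances between atoms of `Ac` and nonzero points of `S0`,
then for every `b ∈ S0`, every optimal solution of Basis Pursuit is subspace-sparse. -/
theorem stmt_2 {D : ℕ} {ι0 ιc : Type*} [Fintype ι0] [Fintype ιc] [Nonempty ι0]
    (a0 : ι0 → EuclideanSpace ℝ (Fin D)) (ac : ιc → EuclideanSpace ℝ (Fin D))
    (ha0 : ∀ j, ‖a0 j‖ = 1) (hac : ∀ j, ‖ac j‖ = 1)
    (S0 : Submodule ℝ (EuclideanSpace ℝ (Fin D)))
    (hS0 : S0 = Submodule.span ℝ (Set.range a0))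
    (hout : ∀ j, ac j ∉ S0)
    (γ0 : ℝ)
    (hγ0 : γ0 = sSup {θ : ℝ | ∃ w ∈ S0, ‖w‖ = 1 ∧ θ = ⨅ j, Real.arccos |⟪a0 j, w⟫|})
    (hPRC : γ0 < sInf {θ : ℝ | ∃ j : ιc, ∃ w ∈ S0, w ≠ 0 ∧
        θ = Real.arccos (⟪ac j, w⟫ / (‖ac j‖ * ‖w‖))}) :
    ∀ b ∈ S0, ∀ x : ι0 ⊕ ιc → ℝ,
      ∑ j, x j • Sum.elim a0 ac j = b →
      ENNReal.ofReal (∑ j, |x j|) =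
        sInf ((fun y : ι0 ⊕ ιc → ℝ => ENNReal.ofReal (∑ j, |y j|)) ''
          {y | ∑ j, y j • Sum.elim a0 ac j = b}) →
      ∀ j : ιc, x (Sum.inr j) = 0 := by
  classical
  intro b hb x hx hopt j
  by_contra hxj
  have hmem : ∀ i, a0 i ∈ S0 := fun i => hS0 ▸ Submodule.subset_span (Set.mem_range_self i)
  have hcover : ∀ w ∈ S0, ‖w‖ = 1 → ⨅ i, Real.arccos |⟪a0 i, w⟫| ≤ γ0 := by
    intro w hw hw1
    rw [hγ0]
    refine le_csSup ⟨Real.pi, ?_⟩ ⟨w, hw, hw1, rfl⟩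
    rintro _ ⟨z, -, -, rfl⟩
    exact (ciInf_le (Set.finite_range _).bddBelow (Classical.arbitrary ι0)).trans
      (Real.arccos_le_pi _)
  have hγ_nonneg : 0 ≤ γ0 :=
    (Real.iInf_nonneg fun _ => Real.arccos_nonneg _).trans
      (hcover _ (hmem (Classical.arbitrary ι0)) (ha0 _))
  have hdist : ∀ i, ∀ w ∈ S0, w ≠ 0 → γ0 < Real.arccos (⟪ac i, w⟫ / (‖ac i‖ * ‖w‖)) := by
    intro i w hw hw0
    refine hPRC.trans_le (csInf_le ⟨0, ?_⟩ ⟨i, w, hw, hw0, rfl⟩)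
    rintro _ ⟨_, _, -, -, rfl⟩
    exact Real.arccos_nonneg _
  have hsep : ∀ i, ∀ w ∈ S0, w ≠ 0 →
      γ0 < Real.pi / 2 ∧ |⟪ac i, w⟫| < Real.cos γ0 * ‖w‖ := fun i w hw hw0 =>
    lt_pi_div_two_and_abs_inner_lt_of_lt_arccos (hac i) hw0 hγ_nonneg (hdist i w hw hw0)
      (hdist i (-w) (S0.neg_mem hw) (neg_ne_zero.2 hw0))
  have hγ_lt : γ0 < Real.pi / 2 := by
    have i := Classical.arbitrary ι0
    exact (hsep j _ (hmem i) (norm_ne_zero_iff.1 (by rw [ha0 i]; exact one_ne_zero))).1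
  have hcos : 0 < Real.cos γ0 := Real.cos_pos_of_mem_Ioo ⟨by linarith [Real.pi_pos], hγ_lt⟩
  rw [Fintype.sum_sum_type] at hx
  simp only [Sum.elim_inl, Sum.elim_inr] at hx
  set v := ∑ i, x (Sum.inr i) • ac i with hv
  have hvS : v ∈ S0 := by
    rw [← eq_sub_iff_add_eq'] at hx
    rw [hx]
    exact S0.sub_mem hb (S0.sum_mem fun i _ => S0.smul_mem _ (hmem i))
  obtain ⟨y, hyv, hy⟩ := exists_sum_smul_eq_of_exists_le_abs_inner a0 S0 hmem hcos
    (fun w hw => exists_cos_mul_norm_le_abs_inner a0 ha0 S0 (by linarith [Real.pi_pos])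
      hcover hw) hvS
  have hnorm : ‖v‖ < Real.cos γ0 * ∑ i, |x (Sum.inr i)| := by
    have hxpos : 0 < |x (Sum.inr j)| := abs_pos.2 hxj
    rcases eq_or_ne v 0 with h0 | h0
    · rw [h0, norm_zero]
      exact mul_pos hcos (hxpos.trans_le (Finset.single_le_sum (f := fun i => |x (Sum.inr i)|)
        (fun _ _ => abs_nonneg _) (Finset.mem_univ j)))
    refine lt_of_mul_lt_mul_right ?_ (norm_nonneg v)
    calc ‖v‖ * ‖v‖ = ∑ i, x (Sum.inr i) * ⟪ac i, v⟫ := by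
          rw [← real_inner_self_eq_norm_mul_norm]
          conv_lhs => rw [hv, sum_inner]
          exact Finset.sum_congr rfl fun i _ => by rw [real_inner_smul_left]
      _ ≤ ∑ i, |x (Sum.inr i)| * |⟪ac i, v⟫| :=
          Finset.sum_le_sum fun i _ => (le_abs_self _).trans (abs_mul _ _).le
      _ < ∑ i, |x (Sum.inr i)| * (Real.cos γ0 * ‖v‖) :=
          Finset.sum_lt_sum
            (fun i _ => mul_le_mul_of_nonneg_left (hsep i v hvS h0).2.le (abs_nonneg _))
            ⟨j, Finset.mem_univ j, mul_lt_mul_of_pos_left (hsep j v hvS h0).2 hxpos⟩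
      _ = Real.cos γ0 * (∑ i, |x (Sum.inr i)|) * ‖v‖ := by
          rw [← Finset.sum_mul]; ring
  have hlt : ∑ i, |y i| < ∑ i, |x (Sum.inr i)| :=
    lt_of_mul_lt_mul_left (hy.trans_lt hnorm) hcos.le
  have hle : ENNReal.ofReal (∑ i, |x i|) ≤
      ENNReal.ofReal (∑ i, |Sum.elim (fun i => x (Sum.inl i) + y i) (fun _ : ιc => 0) i|) := by
    rw [hopt]
    refine sInf_le ⟨_, ?_, rfl⟩
    simp [Fintype.sum_sum_type, add_smul, Finset.sum_add_distrib, hyv, hx]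
  rw [ENNReal.ofReal_le_ofReal_iff (Finset.sum_nonneg fun _ _ => abs_nonneg _),
    Fintype.sum_sum_type, Fintype.sum_sum_type] at hle
  simp only [Sum.elim_inl, Sum.elim_inr, abs_zero, Finset.sum_const_zero, add_zero] at hle
  have htri : ∑ i, |x (Sum.inl i) + y i| ≤ ∑ i, |x (Sum.inl i)| + ∑ i, |y i| := by
    rw [← Finset.sum_add_distrib]
    exact Finset.sum_le_sum fun i _ => abs_add_le _ _
  linarith
end
end

section
/- Suppose the dictionary A = A0 ∪ Ac satisfies the dual recovery condition (DRC): γ0 < s(Ac, D0), where γ0 is the covering radius of ±A0 and D0 is the set of dual points of A0. Then for every b ∈ S0, every optimal solution of Basis Pursuit is subspace-sparse: if x ∈ ℝ^J satisfies Σ_j x_j a_j = b and ‖x‖₁ = p(A, b), then x_j = 0 for all j ∈ Jc. -/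
open scoped RealInnerProductSpace ENNReal

noncomputable section

section PolarDuality

variable {E ι : Type*} [NormedAddCommGroup E] [InnerProductSpace ℝ E] [FiniteDimensional ℝ E]
  [Fintype ι]

/-- A vector of the span of a finite family whose inner product with every element of the relative
polar set is less than `1` is a combination of the family with `ℓ¹` coefficient norm less than
`1`. -/
theorem exists_sum_smul_eq_of_inner_polar_lt_one (a : ι → E) {p : E}
    (hp : p ∈ Submodule.span ℝ (Set.range a))
    (h : ∀ v ∈ Submodule.span ℝ (Set.range a), (∀ j, |⟪a j, v⟫| ≤ 1) → ⟪p, v⟫ < 1) :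
    ∃ y : ι → ℝ, ∑ j, y j • a j = p ∧ ∑ j, |y j| < 1 := by
  set S := Submodule.span ℝ (Set.range a)
  have ha : ∀ j, a j ∈ S := fun j => Submodule.subset_span ⟨j, rfl⟩
  let T : (ι → ℝ) →ₗ[ℝ] S := Fintype.linearCombination ℝ (fun j => (⟨a j, ha j⟩ : S))
  have hT : ∀ y, ((T y : S) : E) = ∑ j, y j • a j := fun y => by
    simp [T, Fintype.linearCombination_apply]
  have hsurj : Function.Surjective T := by
    rintro ⟨q, hq⟩
    obtain ⟨c, hc⟩ := (Submodule.mem_span_range_iff_exists_fun ℝ).1 hq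
    exact ⟨c, Subtype.ext ((hT c).trans hc)⟩
  let B : Set (ι → ℝ) := {y | ∑ j, |y j| < 1}
  have hBo : IsOpen B := isOpen_lt (by fun_prop) continuous_const
  have hBc : Convex ℝ B := by
    intro x hx y hy s t hs ht hst
    have hx' : ∑ j, |x j| < 1 := hx
    have hy' : ∑ j, |y j| < 1 := hy
    have hle : ∑ j, |(s • x + t • y) j| ≤ s * ∑ j, |x j| + t * ∑ j, |y j| := by
      rw [Finset.mul_sum, Finset.mul_sum, ← Finset.sum_add_distrib]
      refine Finset.sum_le_sum fun j _ => (abs_add_le _ _).trans ?_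
      simp [abs_mul, abs_of_nonneg hs, abs_of_nonneg ht]
    change ∑ j, |(s • x + t • y) j| < 1
    rcases hs.eq_or_lt with rfl | hs'
    · have : t = 1 := by linarith
      subst this
      linarith
    · nlinarith
  have hopen : IsOpen (T '' B) := (LinearMap.isOpenMap_of_finiteDimensional T hsurj) B hBo
  by_cases hmem : (⟨p, hp⟩ : S) ∈ T '' B
  · obtain ⟨y, hy, hyp⟩ := hmem
    exact ⟨y, by rw [← hT, hyp], hy⟩
  exfalso
  obtain ⟨f, hf⟩ := geometric_hahn_banach_open_point (hBc.linear_image T) hopen hmem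
  set r := f ⟨p, hp⟩ with hr
  have hr0 : 0 < r := by
    have := hf (T 0) ⟨0, by simp [B], rfl⟩
    simpa using this
  obtain ⟨v, hv⟩ := (InnerProductSpace.toDual ℝ S).surjective f
  have hfv : ∀ q : S, f q = ⟪(q : E), (v : E)⟫ := fun q => by
    rw [← hv, InnerProductSpace.toDual_apply_apply, real_inner_comm, Submodule.coe_inner]
  have habs : ∀ j, |⟪a j, (v : E)⟫| ≤ r := by
    classical
    intro j
    have key : ∀ t : ℝ, |t| < 1 → t * ⟪a j, (v : E)⟫ < r := by
      intro t ht
      have hmem : T (Pi.single j t) ∈ T '' B := ⟨_, by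
        simpa [B, Pi.single_apply, apply_ite abs] using ht, rfl⟩
      have := hf _ hmem
      rw [hfv, hT] at this
      simpa [Pi.single_apply, ite_smul, inner_smul_left] using this
    have key' : ∀ t ∈ Set.Ico (0 : ℝ) 1, t * |⟪a j, (v : E)⟫| ≤ r := by
      rintro t ⟨ht0, ht1⟩
      rcases abs_cases ⟪a j, (v : E)⟫ with ⟨h1, -⟩ | ⟨h1, -⟩
      · rw [h1]
        exact (key t (by rwa [abs_of_nonneg ht0])).le
      · rw [h1]
        have := key (-t) (by rwa [abs_neg, abs_of_nonneg ht0])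
        linarith
    by_contra! hlt
    have hpos := hr0.trans hlt
    obtain ⟨m, hm1, hm2⟩ := exists_between hlt
    have := key' (m / |⟪a j, (v : E)⟫|) ⟨div_nonneg (hr0.trans hm1).le hpos.le, (div_lt_one hpos).2 hm2⟩
    rw [div_mul_cancel₀ _ hpos.ne'] at this
    linarith
  have hlt := h (r⁻¹ • (v : E)) (S.smul_mem _ v.2) fun j => by
    rw [inner_smul_right, abs_mul, abs_of_pos (inv_pos.2 hr0), inv_mul_le_iff₀ hr0]
    simpa using habs j
  rw [inner_smul_right, ← hfv ⟨p, hp⟩, ← hr, inv_mul_cancel₀ hr0.ne'] at hlt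
  exact hlt.false

/-- The relative polar set of a finite family is compact. -/
theorem isCompact_relativePolar (a : ι → E) :
    IsCompact {v | v ∈ Submodule.span ℝ (Set.range a) ∧ ∀ j, |⟪a j, v⟫| ≤ 1} := by
  set S := Submodule.span ℝ (Set.range a)
  let T : S →ₗ[ℝ] (ι → ℝ) := LinearMap.pi fun j => (innerₛₗ ℝ (a j)).comp S.subtype
  have hT : ∀ v j, T v j = ⟪a j, (v : E)⟫ := fun v j => rfl
  have hinj : LinearMap.ker T = ⊥ := by
    refine LinearMap.ker_eq_bot'.2 fun v hv => ?_
    have hperp : (v : E) ∈ Sᗮ := by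
      refine (Submodule.mem_orthogonal S _).2 fun u hu => ?_
      induction hu using Submodule.span_induction with
      | mem u hu =>
        obtain ⟨j, rfl⟩ := hu
        rw [← hT, hv]
        rfl
      | zero => simp
      | add u w _ _ h1 h2 => rw [inner_add_left, h1, h2, add_zero]
      | smul c u _ h1 => rw [inner_smul_left, h1, mul_zero]
    have := (Submodule.mem_orthogonal S (v : E)).1 hperp v v.2
    exact Subtype.ext (inner_self_eq_zero.1 this)
  have hcpt : IsCompact (T ⁻¹' Metric.closedBall 0 1) :=
    (LinearMap.isClosedEmbedding_of_injective hinj).isCompact_preimage (isCompact_closedBall _ _)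
  convert hcpt.image continuous_subtype_val using 1
  ext v
  simp [pi_norm_le_iff_of_nonneg, hT, S, and_comm]

end PolarDuality

/-- A continuous linear functional less than `c` at every extreme point of a compact set is less
than `c` on the whole set. -/
theorem IsCompact.lt_of_forall_extremePoints_lt {E : Type*} [NormedAddCommGroup E]
    [NormedSpace ℝ E] {K : Set E} (hK : IsCompact K) (f : StrongDual ℝ E) {c : ℝ}
    (h : ∀ v ∈ K.extremePoints ℝ, f v < c) {v : E} (hv : v ∈ K) : f v < c := by
  obtain ⟨m, hm, hmax⟩ := hK.exists_isMaxOn ⟨v, hv⟩ f.continuous.continuousOn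
  have hexp : IsExposed ℝ K (f.toExposed K) := ContinuousLinearMap.toExposed.isExposed
  have hne : (f.toExposed K).Nonempty := ⟨m, hm, fun y hy => hmax hy⟩
  obtain ⟨e, he⟩ := (hexp.isCompact hK).extremePoints_nonempty hne
  exact (he.1.2 v hv).trans_lt (h e (hexp.isExtreme.extremePoints_subset_extremePoints he))


/-- If a dictionary `A = A0 ∪ Ac` of unit vectors (with `A0 = (a0 j)` spanning
`S0` and every atom `ac j` outside `S0`) satisfies the dual recovery condition (DRC)
`γ0 < s(Ac, D0)`, where `γ0` is the covering radius of `±A0` and `D0` is the set of dual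
points of `A0` (the extreme points of the relative polar set
`K0° = {v ∈ S0 | ∀ j, |⟪a0 j, v⟫| ≤ 1}`), then for every `b ∈ S0`, every optimal solution
of Basis Pursuit is subspace-sparse. -/
theorem stmt_3 {D : ℕ} {ι0 ιc : Type*} [Fintype ι0] [Fintype ιc] [Nonempty ι0]
    (a0 : ι0 → EuclideanSpace ℝ (Fin D)) (ac : ιc → EuclideanSpace ℝ (Fin D))
    (ha0 : ∀ j, ‖a0 j‖ = 1) (hac : ∀ j, ‖ac j‖ = 1)
    (S0 : Submodule ℝ (EuclideanSpace ℝ (Fin D)))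
    (hS0 : S0 = Submodule.span ℝ (Set.range a0))
    (hout : ∀ j, ac j ∉ S0)
    (γ0 : ℝ)
    (hγ0 : γ0 = sSup {θ : ℝ | ∃ w ∈ S0, ‖w‖ = 1 ∧ θ = ⨅ j, Real.arccos |⟪a0 j, w⟫|})
    (D0 : Set (EuclideanSpace ℝ (Fin D)))
    (hD0 : D0 = Set.extremePoints ℝ {v | v ∈ S0 ∧ ∀ j, |⟪a0 j, v⟫| ≤ 1})
    (hDRC : γ0 < sInf {θ : ℝ | ∃ j : ιc, ∃ v ∈ D0, v ≠ 0 ∧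
        θ = Real.arccos (⟪ac j, v⟫ / (‖ac j‖ * ‖v‖))}) :
    ∀ b ∈ S0, ∀ x : ι0 ⊕ ιc → ℝ,
      ∑ j, x j • Sum.elim a0 ac j = b →
      ENNReal.ofReal (∑ j, |x j|) =
        sInf ((fun y : ι0 ⊕ ιc → ℝ => ENNReal.ofReal (∑ j, |y j|)) ''
          {y | ∑ j, y j • Sum.elim a0 ac j = b}) →
      ∀ j : ιc, x (Sum.inr j) = 0 := by
  intro b hb x hx hopt
  set K : Set (EuclideanSpace ℝ (Fin D)) := {v | v ∈ S0 ∧ ∀ j, |⟪a0 j, v⟫| ≤ 1} with hK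
  have hfin : ∀ w, BddBelow (Set.range fun j => Real.arccos |⟪a0 j, w⟫|) :=
    fun w => (Set.finite_range _).bddBelow
  have hbdd : BddAbove {θ : ℝ | ∃ w ∈ S0, ‖w‖ = 1 ∧ θ = ⨅ j, Real.arccos |⟪a0 j, w⟫|} := by
    refine ⟨Real.pi, ?_⟩
    rintro _ ⟨w, -, -, rfl⟩
    exact (ciInf_le (hfin w) (Classical.arbitrary ι0)).trans (Real.arccos_le_pi _)
  have hγ_nonneg : 0 ≤ γ0 := by
    rw [hγ0]
    refine Real.sSup_nonneg ?_
    rintro _ ⟨w, -, -, rfl⟩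
    exact Real.iInf_nonneg fun j => Real.arccos_nonneg _
  have hcover : ∀ v ∈ K, ‖v‖ * Real.cos γ0 ≤ 1 := by
    rintro v ⟨hvS, hv⟩
    rcases eq_or_ne v 0 with rfl | hv0
    · simp
    have hn : 0 < ‖v‖ := norm_pos_iff.2 hv0
    obtain ⟨j, hj⟩ := exists_eq_ciInf_of_finite
      (f := fun j => Real.arccos |⟪a0 j, ‖v‖⁻¹ • v⟫|)
    have hle : Real.arccos |⟪a0 j, ‖v‖⁻¹ • v⟫| ≤ γ0 := by
      rw [hγ0]
      exact le_csSup hbdd ⟨_, S0.smul_mem _ hvS, norm_smul_inv_norm hv0, hj⟩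
    have hval : |⟪a0 j, ‖v‖⁻¹ • v⟫| = ‖v‖⁻¹ * |⟪a0 j, v⟫| := by
      rw [inner_smul_right, abs_mul, abs_of_pos (inv_pos.2 hn)]
    have hle1 : |⟪a0 j, ‖v‖⁻¹ • v⟫| ≤ 1 :=
      (abs_real_inner_le_norm _ _).trans (by
        rw [ha0, one_mul, norm_smul, norm_inv, norm_norm, inv_mul_cancel₀ hn.ne'])
    have hγπ : γ0 ≤ Real.pi := by
      rw [hγ0]
      refine Real.sSup_le ?_ Real.pi_pos.le
      rintro _ ⟨w, -, -, rfl⟩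
      exact (ciInf_le (hfin w) (Classical.arbitrary ι0)).trans (Real.arccos_le_pi _)
    have hcos := Real.cos_le_cos_of_nonneg_of_le_pi (Real.arccos_nonneg _) hγπ hle
    rw [Real.cos_arccos (by linarith [abs_nonneg ⟪a0 j, ‖v‖⁻¹ • v⟫]) hle1, hval,
      le_inv_mul_iff₀ hn] at hcos
    exact hcos.trans (hv j)
  have hext : ∀ i, ∀ v ∈ K.extremePoints ℝ, ⟪ac i, v⟫ < 1 := by
    intro i v hv
    rcases eq_or_ne v 0 with rfl | hv0
    · simp
    have hn : 0 < ‖v‖ := norm_pos_iff.2 hv0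
    have hlt : γ0 < Real.arccos (⟪ac i, v⟫ / (‖ac i‖ * ‖v‖)) := by
      refine hDRC.trans_le (csInf_le ⟨0, ?_⟩ ⟨i, v, hD0 ▸ hv, hv0, rfl⟩)
      rintro _ ⟨_, _, _, _, rfl⟩
      exact Real.arccos_nonneg _
    have hcos := Real.cos_lt_cos_of_nonneg_of_le_pi hγ_nonneg (Real.arccos_le_pi _) hlt
    have habs := abs_le.1 (abs_real_inner_div_norm_mul_norm_le_one (ac i) v)
    rw [Real.cos_arccos habs.1 habs.2, hac, one_mul, div_lt_iff₀ hn] at hcos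
    have := hcover v hv.1
    linarith
  have hKc : IsCompact K := by
    rw [hK, hS0]
    exact isCompact_relativePolar a0
  have hrep : ∀ i, ∃ y : ι0 → ℝ, ∑ j, y j • a0 j = S0.starProjection (ac i) ∧ ∑ j, |y j| < 1 := by
    intro i
    refine exists_sum_smul_eq_of_inner_polar_lt_one a0
      (hS0 ▸ Submodule.starProjection_apply_mem S0 (ac i)) fun v hv hv1 => ?_
    rw [← hS0] at hv
    rw [Submodule.inner_starProjection_left_eq_right, Submodule.starProjection_eq_self_iff.2 hv]
    exact hKc.lt_of_forall_extremePoints_lt (innerSL ℝ (ac i)) (hext i) ⟨hv, hv1⟩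
  choose y hy hy1 using hrep
  by_contra! hne
  obtain ⟨i₀, hi₀⟩ := hne
  let z : ι0 ⊕ ιc → ℝ := Sum.elim (fun j => x (Sum.inl j) + ∑ i, x (Sum.inr i) * y i j) 0
  have hz : ∑ j, z j • Sum.elim a0 ac j = b := by
    have hproj := congrArg S0.starProjection hx
    have hP0 : ∀ j, S0.starProjection (a0 j) = a0 j := fun j =>
      Submodule.starProjection_eq_self_iff.2 (hS0 ▸ Submodule.subset_span ⟨j, rfl⟩)
    rw [Submodule.starProjection_eq_self_iff.2 hb] at hproj
    simp only [Fintype.sum_sum_type, Sum.elim_inl, Sum.elim_inr, map_add, map_sum, map_smul, hP0,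
      ← hy, Finset.smul_sum] at hproj
    rw [← hproj, Finset.sum_comm (s := (Finset.univ : Finset ιc))]
    simp [z, Fintype.sum_sum_type, add_smul, Finset.sum_smul, Finset.sum_add_distrib, mul_smul]
  have hle : ∑ j, |x j| ≤ ∑ j, |z j| := by
    refine (ENNReal.ofReal_le_ofReal_iff (Finset.sum_nonneg fun j _ => abs_nonneg _)).1 ?_
    rw [hopt]
    exact sInf_le ⟨z, hz, rfl⟩
  have hbound : ∑ j, |z j| ≤
      ∑ j, |x (Sum.inl j)| + ∑ i, |x (Sum.inr i)| * ∑ j, |y i j| := by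
    simp only [z, Fintype.sum_sum_type, Sum.elim_inl, Sum.elim_inr, Pi.zero_apply, abs_zero,
      Finset.sum_const_zero, add_zero, Finset.mul_sum]
    rw [Finset.sum_comm (s := (Finset.univ : Finset ιc)), ← Finset.sum_add_distrib]
    refine Finset.sum_le_sum fun j _ => (abs_add_le _ _).trans ?_
    gcongr
    refine (Finset.abs_sum_le_sum_abs _ _).trans_eq ?_
    simp only [abs_mul]
  have hstrict : ∑ i, |x (Sum.inr i)| * ∑ j, |y i j| < ∑ i, |x (Sum.inr i)| :=
    Finset.sum_lt_sum (fun i _ => mul_le_of_le_one_right (abs_nonneg _) (hy1 i).le)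
      ⟨i₀, Finset.mem_univ _, mul_lt_of_lt_one_right (abs_pos.2 hi₀) (hy1 i₀)⟩
  rw [Fintype.sum_sum_type] at hle
  linarith
end
end

section
/- For a dictionary A = A0 ∪ Ac, the following are equivalent: (i) for every b ∈ S0, every optimal solution x of Basis Pursuit (Σ_j x_j a_j = b with ‖x‖₁ = p(A, b)) satisfies x_j = 0 for all j ∈ Jc; (ii) for every b ∈ S0 with b ≠ 0, p(A0, b) < p(Ac, b). -/
open scoped RealInnerProductSpace ENNReal

noncomputable section

/-- The Basis Pursuit value of a feasible right-hand side is attained. -/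
theorem exists_basisPursuit_minimizer {E ι : Type*} [NormedAddCommGroup E] [NormedSpace ℝ E]
    [Fintype ι] (v : ι → E) {b : E} {x₀ : ι → ℝ} (hx₀ : ∑ j, x₀ j • v j = b) :
    ∃ x : ι → ℝ, ∑ j, x j • v j = b ∧
      ∀ y : ι → ℝ, ∑ j, y j • v j = b → ∑ j, |x j| ≤ ∑ j, |y j| := by
  have hclosed : IsClosed {x : ι → ℝ | ∑ j, x j • v j = b} :=
    isClosed_eq (by fun_prop) continuous_const
  have hcoercive : Filter.Tendsto (fun x : ι → ℝ => ∑ j, |x j|)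
      (Filter.cocompact (ι → ℝ)) Filter.atTop := by
    refine Filter.tendsto_atTop_mono (fun x => ?_) (tendsto_norm_cocompact_atTop (E := ι → ℝ))
    refine (pi_norm_le_iff_of_nonneg (Finset.sum_nonneg fun j _ => abs_nonneg (x j))).2 fun j => ?_
    exact Finset.single_le_sum (f := fun j => |x j|) (fun j _ => abs_nonneg (x j))
      (Finset.mem_univ j)
  obtain ⟨x, hx, hmin⟩ := ContinuousOn.exists_isMinOn'
    (f := fun x : ι → ℝ => ∑ j, |x j|) (by fun_prop) hclosed hx₀
    ((hcoercive.eventually_ge_atTop _).filter_mono inf_le_left)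
  exact ⟨x, hx, fun y hy => hmin hy⟩

/-- A feasible point of least `ℓ¹` norm realizes the Basis Pursuit value. -/
theorem basisPursuit_value_eq {E ι : Type*} [AddCommGroup E] [Module ℝ E]
    [Fintype ι] (v : ι → E) {b : E} {x : ι → ℝ} (hx : ∑ j, x j • v j = b)
    (hmin : ∀ y : ι → ℝ, ∑ j, y j • v j = b → ∑ j, |x j| ≤ ∑ j, |y j|) :
    sInf ((fun y : ι → ℝ => ENNReal.ofReal (∑ j, |y j|)) '' {y | ∑ j, y j • v j = b}) =
      ENNReal.ofReal (∑ j, |x j|) := by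
  refine le_antisymm (sInf_le ⟨x, hx, rfl⟩) (le_sInf ?_)
  rintro _ ⟨y, hy, rfl⟩
  exact ENNReal.ofReal_le_ofReal (hmin y hy)

/-- An optimal solution has least `ℓ¹` norm among the feasible points. -/
theorem sum_abs_le_of_eq_basisPursuit_value {E ι : Type*} [AddCommGroup E] [Module ℝ E]
    [Fintype ι] (v : ι → E) {b : E} {x : ι → ℝ}
    (hx : ENNReal.ofReal (∑ j, |x j|) =
      sInf ((fun y : ι → ℝ => ENNReal.ofReal (∑ j, |y j|)) '' {y | ∑ j, y j • v j = b}))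
    {y : ι → ℝ} (hy : ∑ j, y j • v j = b) : ∑ j, |x j| ≤ ∑ j, |y j| := by
  rw [← ENNReal.ofReal_le_ofReal_iff (Finset.sum_nonneg fun j _ => abs_nonneg (y j)), hx]
  exact sInf_le ⟨y, hy, rfl⟩

/-- For a dictionary `A = A0 ∪ Ac` of unit vectors (with `A0 = (a0 j)` spanning
`S0` and every atom `ac j` outside `S0`), the following are equivalent:
(i) for every `b ∈ S0`, every optimal solution of Basis Pursuit with the full dictionary is
subspace-sparse; (ii) for every nonzero `b ∈ S0`, `p(A0, b) < p(Ac, b)`, where `p(B, b)` is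
the Basis Pursuit value (an extended real, `+∞` when infeasible). -/
theorem stmt_4 {D : ℕ} {ι0 ιc : Type*} [Fintype ι0] [Fintype ιc]
    (a0 : ι0 → EuclideanSpace ℝ (Fin D)) (ac : ιc → EuclideanSpace ℝ (Fin D))
    (ha0 : ∀ j, ‖a0 j‖ = 1) (hac : ∀ j, ‖ac j‖ = 1)
    (S0 : Submodule ℝ (EuclideanSpace ℝ (Fin D)))
    (hS0 : S0 = Submodule.span ℝ (Set.range a0))
    (hout : ∀ j, ac j ∉ S0) :
    (∀ b ∈ S0, ∀ x : ι0 ⊕ ιc → ℝ,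
        ∑ j, x j • Sum.elim a0 ac j = b →
        ENNReal.ofReal (∑ j, |x j|) =
          sInf ((fun y : ι0 ⊕ ιc → ℝ => ENNReal.ofReal (∑ j, |y j|)) ''
            {y | ∑ j, y j • Sum.elim a0 ac j = b}) →
        ∀ j : ιc, x (Sum.inr j) = 0)
    ↔
    (∀ b ∈ S0, b ≠ 0 →
      sInf ((fun x : ι0 → ℝ => ENNReal.ofReal (∑ j, |x j|)) ''
          {x | ∑ j, x j • a0 j = b}) <
      sInf ((fun x : ιc → ℝ => ENNReal.ofReal (∑ j, |x j|)) ''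
          {x | ∑ j, x j • ac j = b})) := by
  constructor
  · intro h b hb hb0
    obtain ⟨u, hu⟩ := (Submodule.mem_span_range_iff_exists_fun ℝ).1 (hS0 ▸ hb)
    obtain ⟨x₀, hx₀, hmin₀⟩ := exists_basisPursuit_minimizer a0 hu
    rw [basisPursuit_value_eq a0 hx₀ hmin₀]
    by_cases hfeas : ∃ y : ιc → ℝ, ∑ j, y j • ac j = b
    · obtain ⟨w, hw⟩ := hfeas
      obtain ⟨y, hy, hminc⟩ := exists_basisPursuit_minimizer ac hw
      rw [basisPursuit_value_eq ac hy hminc]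
      by_contra hlt
      have hle : ∑ j, |y j| ≤ ∑ j, |x₀ j| :=
        (ENNReal.ofReal_le_ofReal_iff (Finset.sum_nonneg fun j _ => abs_nonneg (x₀ j))).1
          (not_lt.1 hlt)
      have hyf : ∑ j, (Sum.elim 0 y : ι0 ⊕ ιc → ℝ) j • Sum.elim a0 ac j = b := by
        simpa [Fintype.sum_sum_type] using hy
      obtain ⟨z, hz, hminz⟩ := exists_basisPursuit_minimizer (Sum.elim a0 ac) hyf
      have hzc := h b hb z hz (basisPursuit_value_eq _ hz hminz).symm
      have hz₀ : ∑ j, z (Sum.inl j) • a0 j = b := by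
        simpa [Fintype.sum_sum_type, hzc] using hz
      have hle' : ∑ j, |x₀ j| ≤ ∑ j, |z j| := by
        simpa [Fintype.sum_sum_type, hzc] using hmin₀ _ hz₀
      have hyc := h b hb _ hyf (basisPursuit_value_eq _ hyf fun t ht => by
        have hzt := hminz t ht
        have hsum : ∑ j, |(Sum.elim 0 y : ι0 ⊕ ιc → ℝ) j| = ∑ j, |y j| := by
          simp [Fintype.sum_sum_type]
        linarith).symm
      exact hb0 (by simpa [show ∀ j, y j = 0 from hyc] using hy.symm)
    · have hempty : {y : ιc → ℝ | ∑ j, y j • ac j = b} = ∅ :=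
        Set.eq_empty_iff_forall_notMem.2 fun y hy => hfeas ⟨y, hy⟩
      simp [hempty]
  · intro h b hb x hx hopt
    have hmin := fun y => sum_abs_le_of_eq_basisPursuit_value (y := y) _ hopt
    simp only [Fintype.sum_sum_type, Sum.elim_inl, Sum.elim_inr] at hx hmin
    have hx₀ : ∑ j, x (Sum.inl j) • a0 j ∈ S0 := by
      rw [hS0]
      exact Submodule.sum_mem _ fun j _ =>
        Submodule.smul_mem _ _ (Submodule.subset_span (Set.mem_range_self j))
    have hxc : ∑ j, x (Sum.inr j) • ac j ∈ S0 := by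
      rw [← hx] at hb
      exact (Submodule.add_mem_iff_right _ hx₀).1 hb
    have key : ∀ u : ι0 → ℝ, ∑ j, u j • a0 j = ∑ j, x (Sum.inr j) • ac j →
        ∑ j, |x (Sum.inr j)| ≤ ∑ j, |u j| := by
      intro u hu
      have hle := hmin (Sum.elim (fun j => x (Sum.inl j) + u j) 0)
        (by simp [add_smul, Finset.sum_add_distrib, hu, hx])
      simp only [Sum.elim_inl, Sum.elim_inr, Pi.zero_apply, abs_zero, Finset.sum_const_zero,
        add_zero] at hle
      have htri : ∑ j, |x (Sum.inl j) + u j| ≤ ∑ j, |x (Sum.inl j)| + ∑ j, |u j| := by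
        rw [← Finset.sum_add_distrib]
        exact Finset.sum_le_sum fun j _ => abs_add_le _ _
      linarith
    by_cases hzero : ∑ j, x (Sum.inr j) • ac j = 0
    · have hle := key 0 (by simp [hzero])
      simp only [Pi.zero_apply, abs_zero, Finset.sum_const_zero] at hle
      have hsum := le_antisymm hle (Finset.sum_nonneg fun j _ => abs_nonneg (x (Sum.inr j)))
      intro j
      exact abs_eq_zero.1 ((Finset.sum_eq_zero_iff_of_nonneg fun j _ => abs_nonneg _).1 hsum j
        (Finset.mem_univ j))
    · obtain ⟨_, ⟨u, hu, rfl⟩, hlt⟩ := sInf_lt_iff.1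
        ((h _ hxc hzero).trans_le (sInf_le ⟨fun j => x (Sum.inr j), rfl, rfl⟩))
      exact absurd (ENNReal.ofReal_le_ofReal (key u hu)) (not_le.2 hlt)
end
end

section
/- If the PRC holds, i.e. γ0 < s(Ac, S0), then for every b ∈ S0 with b ≠ 0 one has p(A0, b) < p(Ac, b). -/
open scoped RealInnerProductSpace ENNReal

noncomputable section

/-- If every vector of `span (range a)` has correlation at least `c` with some atom `±a j`, then the
ball of radius `c` in the span lies in the symmetrized convex hull of the atoms. -/
theorem exists_sum_smul_eq_and_sum_abs_le {E ι : Type*} [NormedAddCommGroup E]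
    [InnerProductSpace ℝ E] [FiniteDimensional ℝ E] [Fintype ι] (a : ι → E) {c : ℝ}
    (h : ∀ w ∈ Submodule.span ℝ (Set.range a), w ≠ 0 → ∃ j, c * ‖w‖ ≤ |⟪a j, w⟫|)
    {u : E} (hu : u ∈ Submodule.span ℝ (Set.range a)) (huc : ‖u‖ ≤ c) :
    ∃ x : ι → ℝ, ∑ j, x j • a j = u ∧ ∑ j, |x j| ≤ 1 := by
  classical
  set S := Submodule.span ℝ (Set.range a)
  set B : Set (ι → ℝ) := {x | ∑ j, |x j| ≤ 1} with hB
  set L : (ι → ℝ) →ₗ[ℝ] E := Fintype.linearCombination ℝ a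
  have hL (x : ι → ℝ) : L x = ∑ j, x j • a j := Fintype.linearCombination_apply ℝ a x
  have hBclosed : IsClosed B := isClosed_le (by fun_prop) continuous_const
  have hBbdd : Bornology.IsBounded B := by
    refine (Metric.isBounded_closedBall (x := (0 : ι → ℝ)) (r := 1)).subset fun x hx ↦ ?_
    rw [mem_closedBall_zero_iff, pi_norm_le_iff_of_nonneg zero_le_one]
    exact fun i ↦ (Finset.single_le_sum (f := fun j ↦ |x j|) (fun j _ ↦ abs_nonneg _)
      (Finset.mem_univ i)).trans hx
  have hBconv : Convex ℝ B := by
    intro x hx y hy s t hs ht hst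
    calc ∑ j, |(s • x + t • y) j| ≤ ∑ j, (s * |x j| + t * |y j|) := by
          refine Finset.sum_le_sum fun j _ ↦ (abs_add_le _ _).trans_eq ?_
          simp [abs_mul, abs_of_nonneg hs, abs_of_nonneg ht]
      _ = s * ∑ j, |x j| + t * ∑ j, |y j| := by
          rw [Finset.sum_add_distrib, Finset.mul_sum, Finset.mul_sum]
      _ ≤ s * 1 + t * 1 := by gcongr <;> assumption
      _ = 1 := by rw [mul_one, mul_one, hst]
  have hK : IsCompact (L '' B) :=
    (Metric.isCompact_of_isClosed_isBounded hBclosed hBbdd).image L.continuous_of_finiteDimensional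
  by_cases huK : u ∈ L '' B
  · obtain ⟨x, hx, rfl⟩ := huK
    exact ⟨x, (hL x).symm, hx⟩
  obtain ⟨f, t, hft, htu⟩ := geometric_hahn_banach_closed_point (hBconv.linear_image L)
    hK.isClosed huK
  set v := (InnerProductSpace.toDual ℝ E).symm f
  set w : E := S.starProjection v
  have hwS : w ∈ S := S.starProjection_apply_mem v
  have hf (y : E) (hy : y ∈ S) : f y = ⟪y, w⟫ := by
    rw [← InnerProductSpace.toDual_symm_apply, real_inner_comm]
    rw [← S.inner_starProjection_left_eq_right, S.starProjection_eq_self_iff.2 hy]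
  have ha (j : ι) : a j ∈ S := Submodule.subset_span ⟨j, rfl⟩
  have hatom (j : ι) (s : ℝ) (hs : |s| = 1) : s * ⟪a j, w⟫ < t := by
    have := hft (L (Pi.single j s)) ⟨_, ?_, rfl⟩
    · simpa [L, hf _ (ha j)] using this
    · have : ∑ i, |(Pi.single j s : ι → ℝ) i| = |s| := by
        rw [Finset.sum_eq_single j] <;> simp +contextual
      exact (this.trans hs).le
  have ht : 0 < t := by simpa using hft 0 ⟨0, by simp [hB], map_zero L⟩
  rw [hf u hu] at htu
  have hw : w ≠ 0 := by
    intro h0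
    rw [h0, inner_zero_right] at htu
    exact lt_asymm ht htu
  obtain ⟨j, hj⟩ := h w hwS hw
  have hlt : |⟪a j, w⟫| < t := by
    rw [abs_lt]
    constructor <;> linarith [hatom j 1 (by simp), hatom j (-1) (by simp)]
  have : ⟪u, w⟫ ≤ c * ‖w‖ := (real_inner_le_norm u w).trans (by gcongr)
  linarith

/-- If every atom has correlation at most `c` with `b`, a representation of `b` has `ℓ¹` norm at
least `‖b‖ / c`. -/
theorem norm_le_mul_sum_abs {E ι : Type*} [NormedAddCommGroup E] [InnerProductSpace ℝ E]
    [Fintype ι] (a : ι → E) {c : ℝ} {b : E} (hb : b ≠ 0) (h : ∀ j, |⟪a j, b⟫| ≤ c * ‖b‖)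
    {x : ι → ℝ} (hx : ∑ j, x j • a j = b) : ‖b‖ ≤ c * ∑ j, |x j| := by
  refine le_of_mul_le_mul_right ?_ (norm_pos_iff.2 hb)
  calc ‖b‖ * ‖b‖ = ⟪∑ j, x j • a j, b⟫ := by rw [hx, real_inner_self_eq_norm_mul_norm]
    _ = ∑ j, x j * ⟪a j, b⟫ := by simp [sum_inner, real_inner_smul_left]
    _ ≤ ∑ j, |x j| * (c * ‖b‖) := by
        refine Finset.sum_le_sum fun j _ ↦ (le_abs_self _).trans ?_
        rw [abs_mul]
        gcongr
        exact h j
    _ = c * (∑ j, |x j|) * ‖b‖ := by rw [← Finset.sum_mul]; ring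

/-- For a dictionary `A = A0 ∪ Ac` of unit vectors (with `A0 = (a0 j)` spanning
`S0` and every atom `ac j` outside `S0`), if the PRC holds, i.e. `γ0 < s(Ac, S0)`, then for
every nonzero `b ∈ S0`, the Basis Pursuit values satisfy `p(A0, b) < p(Ac, b)` (as extended
reals, `+∞` when infeasible). -/
theorem stmt_5 {D : ℕ} {ι0 ιc : Type*} [Fintype ι0] [Fintype ιc] [Nonempty ι0]
    (a0 : ι0 → EuclideanSpace ℝ (Fin D)) (ac : ιc → EuclideanSpace ℝ (Fin D))
    (ha0 : ∀ j, ‖a0 j‖ = 1) (hac : ∀ j, ‖ac j‖ = 1)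
    (S0 : Submodule ℝ (EuclideanSpace ℝ (Fin D)))
    (hS0 : S0 = Submodule.span ℝ (Set.range a0))
    (hout : ∀ j, ac j ∉ S0)
    (γ0 : ℝ)
    (hγ0 : γ0 = sSup {θ : ℝ | ∃ w ∈ S0, ‖w‖ = 1 ∧ θ = ⨅ j, Real.arccos |⟪a0 j, w⟫|})
    (hPRC : γ0 < sInf {θ : ℝ | ∃ j : ιc, ∃ w ∈ S0, w ≠ 0 ∧
        θ = Real.arccos (⟪ac j, w⟫ / (‖ac j‖ * ‖w‖))}) :
    ∀ b ∈ S0, b ≠ 0 →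
      sInf ((fun x : ι0 → ℝ => ENNReal.ofReal (∑ j, |x j|)) ''
          {x | ∑ j, x j • a0 j = b}) <
      sInf ((fun x : ιc → ℝ => ENNReal.ofReal (∑ j, |x j|)) ''
          {x | ∑ j, x j • ac j = b}) := by
  intro b hb hb0
  rcases Set.eq_empty_or_nonempty {x : ιc → ℝ | ∑ j, x j • ac j = b} with he | ⟨y, hy⟩
  · rw [he, Set.image_empty, sInf_empty]
    obtain ⟨x, hx⟩ := (Submodule.mem_span_range_iff_exists_fun ℝ).1 (hS0 ▸ hb)
    refine lt_of_le_of_lt (sInf_le (Set.mem_image_of_mem _ ?_))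
      (ENNReal.ofReal_lt_top (r := ∑ j, |x j|))
    exact hx
  set T : Set ℝ := {θ : ℝ | ∃ j : ιc, ∃ w ∈ S0, w ≠ 0 ∧
    θ = Real.arccos (⟪ac j, w⟫ / (‖ac j‖ * ‖w‖))}
  have hT0 : ∀ θ ∈ T, 0 ≤ θ := by
    rintro _ ⟨j, w, -, -, rfl⟩
    exact Real.arccos_nonneg _
  have hs0 : 0 ≤ sInf T := Real.sInf_nonneg hT0
  have hcorr (j : ιc) (w : EuclideanSpace ℝ (Fin D)) (hw : w ∈ S0) (hw0 : w ≠ 0) :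
      ⟪ac j, w⟫ ≤ Real.cos (sInf T) * ‖w‖ := by
    have hle : sInf T ≤ Real.arccos (⟪ac j, w⟫ / (‖ac j‖ * ‖w‖)) :=
      csInf_le ⟨0, hT0⟩ ⟨j, w, hw, hw0, rfl⟩
    have hcos := Real.cos_le_cos_of_nonneg_of_le_pi hs0 (Real.arccos_le_pi _) hle
    have habs := abs_le.1 (abs_real_inner_div_norm_mul_norm_le_one (ac j) w)
    rw [Real.cos_arccos habs.1 habs.2, hac, one_mul, div_le_iff₀ (norm_pos_iff.2 hw0)] at hcos
    exact hcos
  have hlower {x : ιc → ℝ} (hx : ∑ j, x j • ac j = b) :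
      ‖b‖ ≤ Real.cos (sInf T) * ∑ j, |x j| := by
    refine norm_le_mul_sum_abs ac hb0 (fun j ↦ abs_le'.2 ⟨hcorr j b hb hb0, ?_⟩) hx
    simpa using hcorr j (-b) (S0.neg_mem hb) (neg_ne_zero.2 hb0)
  have hbpos : 0 < ‖b‖ := norm_pos_iff.2 hb0
  have hcs : 0 < Real.cos (sInf T) :=
    pos_of_mul_pos_left (hbpos.trans_le (hlower hy)) (Finset.sum_nonneg fun _ _ ↦ abs_nonneg _)
  have hspi : sInf T ≤ Real.pi := by
    obtain ⟨j⟩ : Nonempty ιc := by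
      by_contra hne
      rw [not_nonempty_iff] at hne
      exact hb0 (by simpa using hy.symm)
    exact (csInf_le ⟨0, hT0⟩ ⟨j, b, hb, hb0, rfl⟩).trans (Real.arccos_le_pi _)
  have hγnn : 0 ≤ γ0 := by
    rw [hγ0]
    refine Real.sSup_nonneg ?_
    rintro _ ⟨w, -, -, rfl⟩
    exact Real.iInf_nonneg fun j ↦ Real.arccos_nonneg _
  have hcγ : Real.cos (sInf T) < Real.cos γ0 :=
    Real.cos_lt_cos_of_nonneg_of_le_pi hγnn hspi hPRC
  have hγpos : 0 < Real.cos γ0 := hcs.trans hcγ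
  have hcover (w : EuclideanSpace ℝ (Fin D)) (hw : w ∈ S0) (hw0 : w ≠ 0) :
      ∃ j, Real.cos γ0 * ‖w‖ ≤ |⟪a0 j, w⟫| := by
    have hwpos : 0 < ‖w‖ := norm_pos_iff.2 hw0
    obtain ⟨j, hj⟩ := exists_eq_ciInf_of_finite
      (f := fun j ↦ Real.arccos |⟪a0 j, (‖w‖⁻¹ : ℝ) • w⟫|)
    have hle : Real.arccos |⟪a0 j, (‖w‖⁻¹ : ℝ) • w⟫| ≤ γ0 := by
      rw [hγ0]
      refine le_csSup ⟨Real.pi, ?_⟩ ⟨_, S0.smul_mem _ hw, norm_smul_inv_norm hw0, hj⟩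
      rintro _ ⟨v, -, -, rfl⟩
      exact (ciInf_le (Set.finite_range _).bddBelow (Classical.arbitrary ι0)).trans
        (Real.arccos_le_pi _)
    have hcos := Real.cos_le_cos_of_nonneg_of_le_pi (Real.arccos_nonneg _)
      (hPRC.le.trans hspi) hle
    have hone : |⟪a0 j, (‖w‖⁻¹ : ℝ) • w⟫| ≤ 1 := by
      refine (abs_real_inner_le_norm _ _).trans_eq ?_
      rw [ha0, one_mul]
      exact norm_smul_inv_norm hw0
    rw [Real.cos_arccos (by linarith [abs_nonneg ⟪a0 j, (‖w‖⁻¹ : ℝ) • w⟫]) hone,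
      real_inner_smul_right, abs_mul, abs_of_pos (inv_pos.2 hwpos), inv_mul_eq_div,
      le_div_iff₀ hwpos] at hcos
    exact ⟨j, hcos⟩
  subst hS0
  obtain ⟨x, hx, hx1⟩ := exists_sum_smul_eq_and_sum_abs_le a0 hcover
    (u := (Real.cos γ0 / ‖b‖) • b) (Submodule.smul_mem _ _ hb) (by
      rw [norm_smul, Real.norm_of_nonneg (by positivity), div_mul_cancel₀ _ hbpos.ne'])
  set r := ‖b‖ / Real.cos γ0
  have hr : 0 < r := div_pos hbpos hγpos
  have hupper : sInf ((fun x : ι0 → ℝ => ENNReal.ofReal (∑ j, |x j|)) ''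
      {x | ∑ j, x j • a0 j = b}) ≤ ENNReal.ofReal r := by
    refine le_trans (sInf_le ((Set.mem_image _ _ _).2 ⟨r • x, ?_, rfl⟩)) (ENNReal.ofReal_le_ofReal ?_)
    · simp only [Set.mem_ofPred_eq, Pi.smul_apply, smul_eq_mul, mul_smul]
      rw [← Finset.smul_sum, hx, smul_smul, div_mul_div_cancel₀ hγpos.ne', div_self hbpos.ne',
        one_smul]
    · simp only [Pi.smul_apply, smul_eq_mul, abs_mul, abs_of_pos hr]
      rw [← Finset.mul_sum]
      exact mul_le_of_le_one_right hr.le hx1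
  refine hupper.trans_lt (lt_of_lt_of_le (b := ENNReal.ofReal (‖b‖ / Real.cos (sInf T))) ?_ ?_)
  · rw [ENNReal.ofReal_lt_ofReal_iff (div_pos hbpos hcs)]
    exact div_lt_div_of_pos_left hbpos hcs hcγ
  · refine le_sInf ?_
    rintro _ ⟨z, hz, rfl⟩
    refine ENNReal.ofReal_le_ofReal ?_
    rw [div_le_iff₀' hcs]
    exact hlower hz
end
end

section
/- If the DRC holds, i.e. γ0 < s(Ac, D0), then every dual point is strictly separated from Ac in the sense that max over j ∈ Jc of |⟨a_j, v⟩| < 1 for every v ∈ D0. -/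
open scoped RealInnerProductSpace

noncomputable section

/-- The extreme points of a symmetric set form a symmetric set. -/
theorem neg_mem_extremePoints {E : Type*} [AddCommGroup E] [Module ℝ E] {K : Set E}
    (hK : ∀ x ∈ K, -x ∈ K) {v : E} (hv : v ∈ Set.extremePoints ℝ K) :
    -v ∈ Set.extremePoints ℝ K := by
  rw [mem_extremePoints_iff_left] at hv ⊢
  refine ⟨hK v hv.1, fun x hx y hy hxy => ?_⟩
  obtain ⟨s, t, hs, ht, hst, h⟩ := hxy
  have hneg : -x = v := hv.2 (-x) (hK x hx) (-y) (hK y hy)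
    ⟨s, t, hs, ht, hst, by rw [smul_neg, smul_neg, ← neg_add, h, neg_neg]⟩
  rw [← hneg, neg_neg]

/-- A nonzero point `v` of the relative polar set gives the lower bound `arccos (1 / ‖v‖)` on the
covering radius. -/
theorem arccos_inv_norm_le_coveringRadius {E ι : Type*} [NormedAddCommGroup E]
    [InnerProductSpace ℝ E] [Finite ι] [Nonempty ι] (a : ι → E) (S : Submodule ℝ E) {v : E}
    (hvS : v ∈ S) (hv : ∀ j, |⟪a j, v⟫| ≤ 1) (hv0 : v ≠ 0) :
    Real.arccos (1 / ‖v‖) ≤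
      sSup {θ : ℝ | ∃ w ∈ S, ‖w‖ = 1 ∧ θ = ⨅ j, Real.arccos |⟪a j, w⟫|} := by
  have hpos : 0 < ‖v‖ := norm_pos_iff.2 hv0
  have hbdd : BddAbove {θ : ℝ | ∃ w ∈ S, ‖w‖ = 1 ∧ θ = ⨅ j, Real.arccos |⟪a j, w⟫|} := by
    refine ⟨Real.pi, ?_⟩
    rintro _ ⟨w, -, -, rfl⟩
    exact (ciInf_le (Set.finite_range _).bddBelow (Classical.arbitrary ι)).trans
      (Real.arccos_le_pi _)
  refine le_trans (le_ciInf fun j => Real.arccos_le_arccos ?_)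
    (le_csSup hbdd ⟨‖v‖⁻¹ • v, S.smul_mem _ hvS, ?_, rfl⟩)
  · rw [real_inner_smul_right, abs_mul, abs_of_pos (inv_pos.2 hpos), inv_mul_eq_div]
    gcongr
    exact hv j
  · rw [norm_smul, norm_inv, norm_norm, inv_mul_cancel₀ hpos.ne']

/-- For a dictionary `A = A0 ∪ Ac` of unit vectors (with `A0 = (a0 j)` spanning
`S0` and every atom `ac j` outside `S0`), if the DRC holds, i.e. `γ0 < s(Ac, D0)` where `D0`
is the set of dual points of `A0`, then every dual point is strictly separated from `Ac`:
`|⟪ac j, v⟫| < 1` for every `j` and every `v ∈ D0` (i.e. the max over `j ∈ Jc` is `< 1`). -/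
theorem stmt_6 {D : ℕ} {ι0 ιc : Type*} [Fintype ι0] [Fintype ιc] [Nonempty ι0]
    (a0 : ι0 → EuclideanSpace ℝ (Fin D)) (ac : ιc → EuclideanSpace ℝ (Fin D))
    (ha0 : ∀ j, ‖a0 j‖ = 1) (hac : ∀ j, ‖ac j‖ = 1)
    (S0 : Submodule ℝ (EuclideanSpace ℝ (Fin D)))
    (hS0 : S0 = Submodule.span ℝ (Set.range a0))
    (hout : ∀ j, ac j ∉ S0)
    (γ0 : ℝ)
    (hγ0 : γ0 = sSup {θ : ℝ | ∃ w ∈ S0, ‖w‖ = 1 ∧ θ = ⨅ j, Real.arccos |⟪a0 j, w⟫|})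
    (D0 : Set (EuclideanSpace ℝ (Fin D)))
    (hD0 : D0 = Set.extremePoints ℝ {v | v ∈ S0 ∧ ∀ j, |⟪a0 j, v⟫| ≤ 1})
    (hDRC : γ0 < sInf {θ : ℝ | ∃ j : ιc, ∃ v ∈ D0, v ≠ 0 ∧
        θ = Real.arccos (⟪ac j, v⟫ / (‖ac j‖ * ‖v‖))}) :
    ∀ v ∈ D0, ∀ j : ιc, |⟪ac j, v⟫| < 1 := by
  subst hγ0
  have key : ∀ v ∈ D0, ∀ j : ιc, v ≠ 0 → ⟪ac j, v⟫ < 1 := by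
    intro v hv j hv0
    have hvK := extremePoints_subset (hD0 ▸ hv)
    have hbdd : BddBelow {θ : ℝ | ∃ j : ιc, ∃ v ∈ D0, v ≠ 0 ∧
        θ = Real.arccos (⟪ac j, v⟫ / (‖ac j‖ * ‖v‖))} := by
      refine ⟨0, ?_⟩
      rintro _ ⟨i, u, -, -, rfl⟩
      exact Real.arccos_nonneg _
    have hlt : Real.arccos (1 / ‖v‖) < Real.arccos (⟪ac j, v⟫ / (‖ac j‖ * ‖v‖)) :=
      ((arccos_inv_norm_le_coveringRadius a0 S0 hvK.1 hvK.2 hv0).trans_lt hDRC).trans_le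
        (csInf_le hbdd ⟨j, v, hv, hv0, rfl⟩)
    rw [hac, one_mul] at hlt
    by_contra! h
    refine hlt.not_ge (Real.arccos_le_arccos ?_)
    gcongr
  intro v hv j
  rcases eq_or_ne v 0 with rfl | hv0
  · simp
  have hneg : -v ∈ D0 := by
    rw [hD0] at hv ⊢
    refine neg_mem_extremePoints ?_ hv
    refine fun x hx => ⟨S0.neg_mem hx.1, fun i => ?_⟩
    rw [inner_neg_right, abs_neg]
    exact hx.2 i
  have h := key (-v) hneg j (neg_ne_zero.2 hv0)
  rw [inner_neg_right] at h
  exact abs_lt.2 ⟨by linarith, key v hv j hv0⟩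
end
end

section
/- Suppose that max over j ∈ Jc of |⟨a_j, v⟩| < 1 for every dual point v ∈ D0. Then for every b ∈ S0 with b ≠ 0 one has p(A0, b) < p(Ac, b). -/
open scoped RealInnerProductSpace ENNReal

noncomputable section

/-- The relative polar of a finite family in its span is compact. -/
theorem isCompact_relative_polar {E ι : Type*} [NormedAddCommGroup E] [InnerProductSpace ℝ E]
    [Fintype ι] (a : ι → E) :
    IsCompact {v | v ∈ Submodule.span ℝ (Set.range a) ∧ ∀ j, |⟪a j, v⟫| ≤ 1} := by
  set S := Submodule.span ℝ (Set.range a) with hS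
  have : FiniteDimensional ℝ S := FiniteDimensional.span_of_finite ℝ (Set.finite_range a)
  let T : S →ₗ[ℝ] (ι → ℝ) := LinearMap.pi fun j => (innerₛₗ ℝ (a j)).comp S.subtype
  have hT : ∀ v j, T v j = ⟪a j, (v : E)⟫ := fun v j => rfl
  have hker : LinearMap.ker T = ⊥ := by
    rw [LinearMap.ker_eq_bot']
    intro v hv
    have h : ∀ w ∈ S, ⟪w, (v : E)⟫ = 0 := by
      intro w hw
      induction hw using Submodule.span_induction with
      | mem x hx =>
        obtain ⟨j, rfl⟩ := hx
        rw [← hT, hv, Pi.zero_apply]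
      | zero => simp
      | add x y _ _ hx hy => rw [inner_add_left, hx, hy, add_zero]
      | smul c x _ hx => rw [real_inner_smul_left, hx, mul_zero]
    exact Subtype.ext (inner_self_eq_zero.mp (h v v.2))
  have hc : IsCompact (T ⁻¹' Metric.closedBall 0 1) :=
    (LinearMap.isClosedEmbedding_of_injective hker).isCompact_preimage
      (isCompact_closedBall 0 1)
  convert hc.image continuous_subtype_val using 1
  ext v
  simp [pi_norm_le_iff_of_nonneg, hT, and_comm]

/-- Strong duality for Basis Pursuit: if `m > 0` bounds `⟪b, ·⟫` on the relative polar, then `b`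
has a representation of `ℓ¹` norm at most `m`. -/
theorem exists_sum_smul_eq_of_forall_polar_le {E ι : Type*} [NormedAddCommGroup E]
    [InnerProductSpace ℝ E] [CompleteSpace E] [Fintype ι] (a : ι → E) {b : E}
    (hb : b ∈ Submodule.span ℝ (Set.range a)) {m : ℝ} (hm : 0 < m)
    (h : ∀ v ∈ Submodule.span ℝ (Set.range a), (∀ j, |⟪a j, v⟫| ≤ 1) → ⟪b, v⟫ ≤ m) :
    ∃ x : ι → ℝ, ∑ j, x j • a j = b ∧ ∑ j, |x j| ≤ m := by
  classical
  set S := Submodule.span ℝ (Set.range a) with hS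
  have : FiniteDimensional ℝ S := FiniteDimensional.span_of_finite ℝ (Set.finite_range a)
  let B : Set (ι → ℝ) := {x | ∑ j, |x j| ≤ 1}
  have hBconv : Convex ℝ B := by
    intro x hx y hy s t hs ht hst
    have hle : ∑ j, |s * x j + t * y j| ≤ s * ∑ j, |x j| + t * ∑ j, |y j| := by
      rw [Finset.mul_sum, Finset.mul_sum, ← Finset.sum_add_distrib]
      refine Finset.sum_le_sum fun j _ => (abs_add_le _ _).trans ?_
      rw [abs_mul, abs_mul, abs_of_nonneg hs, abs_of_nonneg ht]
    have hx' : ∑ j, |x j| ≤ 1 := hx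
    have hy' : ∑ j, |y j| ≤ 1 := hy
    change ∑ j, |s * x j + t * y j| ≤ 1
    nlinarith
  have hBcomp : IsCompact B := by
    refine (isCompact_closedBall (0 : ι → ℝ) 1).of_isClosed_subset
      (isClosed_le (by fun_prop) continuous_const) fun x hx => ?_
    rw [mem_closedBall_zero_iff, pi_norm_le_iff_of_nonneg zero_le_one]
    exact fun j => (Finset.single_le_sum (f := fun j => |x j|) (fun _ _ => abs_nonneg _)
      (Finset.mem_univ j)).trans hx
  let L : (ι → ℝ) →ₗ[ℝ] E := Fintype.linearCombination ℝ a
  have hL : ∀ x, L x = ∑ j, x j • a j := fun x => Fintype.linearCombination_apply ℝ a x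
  have hLc : Continuous L := L.continuous_of_finiteDimensional
  have hmem : m⁻¹ • b ∈ L '' B := by
    by_contra hnot
    obtain ⟨f, u, hfu, huf⟩ := geometric_hahn_banach_closed_point (hBconv.linear_image L)
      (hBcomp.image hLc).isClosed hnot
    have hu : 0 < u := by
      simpa using hfu 0 ⟨0, by simp [B], by simp⟩
    let w := (InnerProductSpace.toDual ℝ E).symm f
    have hw : ∀ z, ⟪w, z⟫ = f z := fun z => InnerProductSpace.toDual_symm_apply
    let w' : E := S.starProjection w
    have hw' : ∀ z ∈ S, ⟪z, w'⟫ = f z := by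
      intro z hz
      rw [← hw z, real_inner_comm]
      exact Submodule.inner_starProjection_left_eq_right S w z |>.trans
        (by rw [Submodule.starProjection_eq_self_iff.mpr hz])
    have hsign : ∀ j, ∀ s : ℝ, |s| = 1 → s * f (a j) < u := by
      intro j s hs
      have := hfu (s • a j) ⟨Pi.single j s, ?_, ?_⟩
      · simpa using this
      · change ∑ i, |(Pi.single j s : ι → ℝ) i| ≤ 1
        rw [Finset.sum_eq_single j] <;> simp +contextual [hs]
      · simp [L, Fintype.linearCombination_apply_single]
    have hle := h (u⁻¹ • w') (S.smul_mem _ (S.starProjection_apply_mem w)) fun j => by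
      rw [real_inner_smul_right, hw' _ (Submodule.subset_span ⟨j, rfl⟩), abs_mul,
        abs_of_pos (inv_pos.mpr hu), inv_mul_le_one₀ hu, abs_le]
      constructor <;> linarith [hsign j 1 (by simp), hsign j (-1) (by simp)]
    rw [real_inner_smul_right, hw' b hb, inv_mul_le_iff₀ hu] at hle
    rw [map_smul, smul_eq_mul, lt_inv_mul_iff₀ hm] at huf
    linarith
  obtain ⟨x, hx, hxb⟩ := hmem
  refine ⟨m • x, ?_, ?_⟩
  · rw [← hL, map_smul, hxb, smul_inv_smul₀ hm.ne']
  · have hx' : ∑ j, |x j| ≤ 1 := hx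
    simp only [Pi.smul_apply, smul_eq_mul, abs_mul, abs_of_pos hm, ← Finset.mul_sum]
    nlinarith

/-- A continuous linear functional attains its maximum over a nonempty compact set at an
extreme point. -/
theorem IsCompact.exists_mem_extremePoints_forall_le {E : Type*} [NormedAddCommGroup E]
    [NormedSpace ℝ E] {K : Set E} (hK : IsCompact K) (hne : K.Nonempty) (f : StrongDual ℝ E) :
    ∃ v ∈ K.extremePoints ℝ, ∀ w ∈ K, f w ≤ f v := by
  obtain ⟨z, hz, hmax⟩ := hK.exists_isMaxOn hne f.continuous.continuousOn
  have hexp : IsExposed ℝ K (f.toExposed K) := ContinuousLinearMap.toExposed.isExposed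
  obtain ⟨v, hv⟩ := (hexp.isCompact hK).extremePoints_nonempty ⟨z, hz, hmax⟩
  exact ⟨v, hexp.isExtreme.extremePoints_subset_extremePoints hv, hv.1.2⟩

/-- For a dictionary `A = A0 ∪ Ac` of unit vectors (with `A0 = (a0 j)` spanning
`S0` and every atom `ac j` outside `S0`), if `|⟪ac j, v⟫| < 1` for every `j ∈ Jc` and every
dual point `v ∈ D0` (the extreme points of the relative polar set of `A0`), then for every
nonzero `b ∈ S0`, the Basis Pursuit values satisfy `p(A0, b) < p(Ac, b)` (as extended reals,
`+∞` when infeasible). -/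
theorem stmt_7 {D : ℕ} {ι0 ιc : Type*} [Fintype ι0] [Fintype ιc]
    (a0 : ι0 → EuclideanSpace ℝ (Fin D)) (ac : ιc → EuclideanSpace ℝ (Fin D))
    (ha0 : ∀ j, ‖a0 j‖ = 1) (hac : ∀ j, ‖ac j‖ = 1)
    (S0 : Submodule ℝ (EuclideanSpace ℝ (Fin D)))
    (hS0 : S0 = Submodule.span ℝ (Set.range a0))
    (hout : ∀ j, ac j ∉ S0)
    (D0 : Set (EuclideanSpace ℝ (Fin D)))
    (hD0 : D0 = Set.extremePoints ℝ {v | v ∈ S0 ∧ ∀ j, |⟪a0 j, v⟫| ≤ 1})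
    (hsep : ∀ v ∈ D0, ∀ j : ιc, |⟪ac j, v⟫| < 1) :
    ∀ b ∈ S0, b ≠ 0 →
      sInf ((fun x : ι0 → ℝ => ENNReal.ofReal (∑ j, |x j|)) ''
          {x | ∑ j, x j • a0 j = b}) <
      sInf ((fun x : ιc → ℝ => ENNReal.ofReal (∑ j, |x j|)) ''
          {x | ∑ j, x j • ac j = b}) := by
  subst hS0 hD0
  intro b hb hb0
  set S := Submodule.span ℝ (Set.range a0) with hS
  set K := {v | v ∈ S ∧ ∀ j, |⟪a0 j, v⟫| ≤ 1} with hK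
  obtain ⟨v, hv, hmax⟩ := (isCompact_relative_polar a0).exists_mem_extremePoints_forall_le
    ⟨0, by simp⟩ (innerSL ℝ b)
  simp only [innerSL_apply_apply] at hmax
  have hbpos : 0 < ‖b‖ := norm_pos_iff.mpr hb0
  have hm : 0 < ⟪b, v⟫ := by
    have hbK : ‖b‖⁻¹ • b ∈ K := by
      refine ⟨S.smul_mem _ hb, fun j => ?_⟩
      refine (abs_real_inner_le_norm _ _).trans ?_
      rw [ha0, norm_smul, norm_inv, norm_norm, inv_mul_cancel₀ hbpos.ne', one_mul]
    refine lt_of_lt_of_le ?_ (hmax _ hbK)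
    rw [real_inner_smul_right, real_inner_self_eq_norm_sq]
    positivity
  obtain ⟨x, hxb, hx⟩ := exists_sum_smul_eq_of_forall_polar_le a0 hb hm
    fun w hw hw' => hmax w ⟨hw, hw'⟩
  obtain ⟨δ, hδ0, hδ1, hδ⟩ : ∃ δ : ℝ, 0 < δ ∧ δ < 1 ∧ ∀ j, |⟪ac j, v⟫| ≤ δ := by
    have hev : ∀ᶠ δ in nhdsWithin (1 : ℝ) (Set.Iio 1), 0 < δ ∧ δ < 1 ∧ ∀ j, |⟪ac j, v⟫| ≤ δ := by
      refine (Filter.Eventually.filter_mono nhdsWithin_le_nhds (lt_mem_nhds one_pos)).and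
        (Filter.Eventually.and self_mem_nhdsWithin (Filter.eventually_all.mpr fun j => ?_))
      exact Filter.Eventually.filter_mono nhdsWithin_le_nhds
        ((lt_mem_nhds (hsep v hv j)).mono fun _ => le_of_lt)
    exact hev.exists
  calc sInf ((fun x : ι0 → ℝ => ENNReal.ofReal (∑ j, |x j|)) '' {x | ∑ j, x j • a0 j = b})
      ≤ ENNReal.ofReal ⟪b, v⟫ := sInf_le_of_le ⟨x, hxb, rfl⟩ (ENNReal.ofReal_le_ofReal hx)
    _ < ENNReal.ofReal (⟪b, v⟫ / δ) := by
      rw [ENNReal.ofReal_lt_ofReal_iff (by positivity), lt_div_iff₀ hδ0]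
      nlinarith
    _ ≤ _ := by
      refine le_sInf ?_
      rintro _ ⟨y, hy, rfl⟩
      refine ENNReal.ofReal_le_ofReal ?_
      have hy' : ∑ j, y j • ac j = b := hy
      rw [div_le_iff₀ hδ0, ← hy', sum_inner, Finset.sum_mul]
      refine Finset.sum_le_sum fun j _ => (le_abs_self _).trans ?_
      rw [real_inner_smul_left, abs_mul]
      exact mul_le_mul_of_nonneg_left (hδ j) (abs_nonneg _)
end
end

section
/- Suppose Jc is nonempty and the PRC holds, i.e. γ0 < s(Ac, S0). Then for every b ∈ S0 with b ≠ 0, the symmetrized spherical distance from b to A0 is strictly smaller than that to Ac: min over j ∈ J0 of arccos|⟨a_j, b/‖b‖₂⟩| < min over j ∈ Jc of arccos|⟨a_j, b/‖b‖₂⟩| (equivalently, max over j ∈ J0 of |⟨a_j, b⟩| > max over j ∈ Jc of |⟨a_j, b⟩|). -/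
open scoped RealInnerProductSpace

noncomputable section

/-- For a dictionary `A = A0 ∪ Ac` of unit vectors (with `A0 = (a0 j)` spanning
`S0`, every atom `ac j` outside `S0`, and `Jc` nonempty), if the PRC holds, i.e.
`γ0 < s(Ac, S0)`, then for every nonzero `b ∈ S0` the symmetrized spherical distance from
`b` to `A0` is strictly smaller than that to `Ac`:
`min_j arccos |⟪a0 j, b/‖b‖⟫| < min_j arccos |⟪ac j, b/‖b‖⟫|`. -/
theorem stmt_8 {D : ℕ} {ι0 ιc : Type*} [Fintype ι0] [Fintype ιc] [Nonempty ι0] [Nonempty ιc]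
    (a0 : ι0 → EuclideanSpace ℝ (Fin D)) (ac : ιc → EuclideanSpace ℝ (Fin D))
    (ha0 : ∀ j, ‖a0 j‖ = 1) (hac : ∀ j, ‖ac j‖ = 1)
    (S0 : Submodule ℝ (EuclideanSpace ℝ (Fin D)))
    (hS0 : S0 = Submodule.span ℝ (Set.range a0))
    (hout : ∀ j, ac j ∉ S0)
    (γ0 : ℝ)
    (hγ0 : γ0 = sSup {θ : ℝ | ∃ w ∈ S0, ‖w‖ = 1 ∧ θ = ⨅ j, Real.arccos |⟪a0 j, w⟫|})
    (hPRC : γ0 < sInf {θ : ℝ | ∃ j : ιc, ∃ w ∈ S0, w ≠ 0 ∧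
        θ = Real.arccos (⟪ac j, w⟫ / (‖ac j‖ * ‖w‖))}) :
    ∀ b : EuclideanSpace ℝ (Fin D), b ∈ S0 → b ≠ 0 →
      (⨅ j, Real.arccos |⟪a0 j, ‖b‖⁻¹ • b⟫|) < ⨅ j, Real.arccos |⟪ac j, ‖b‖⁻¹ • b⟫| := by
  intro b hb hb0
  set u := ‖b‖⁻¹ • b with hu
  have hu1 : ‖u‖ = 1 := norm_smul_inv_norm (𝕜 := ℝ) hb0
  have huS : u ∈ S0 := S0.smul_mem _ hb
  have hu0 : u ≠ 0 := norm_ne_zero_iff.mp (by rw [hu1]; exact one_ne_zero)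
  have hle : (⨅ j, Real.arccos |⟪a0 j, u⟫|) ≤ γ0 := by
    rw [hγ0]
    refine le_csSup ⟨Real.pi, ?_⟩ ⟨u, huS, hu1, rfl⟩
    rintro _ ⟨w, -, -, rfl⟩
    exact (ciInf_le (Set.finite_range _).bddBelow (Classical.arbitrary ι0)).trans
      (Real.arccos_le_pi _)
  refine (hle.trans_lt hPRC).trans_le (le_ciInf fun j => csInf_le ⟨0, ?_⟩ ?_)
  · rintro _ ⟨i, w, -, -, rfl⟩
    exact Real.arccos_nonneg _
  · rcases abs_choice ⟪ac j, u⟫ with h | h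
    · exact ⟨j, u, huS, hu0, by rw [h, hac, hu1, mul_one, div_one]⟩
    · exact ⟨j, -u, S0.neg_mem huS, neg_ne_zero.mpr hu0, by
        rw [h, hac, norm_neg, hu1, mul_one, div_one, inner_neg_right]⟩
end
end

section
/- Let A0 = {a_j : j ∈ J0} be a finite set of unit vectors spanning a subspace S0 of ℝ^D with covering radius γ0 of ±A0. Then for every b ∈ S0, the Basis Pursuit value satisfies p(A0, b) ≤ ‖b‖₂ / cos γ0; in particular there exists x ∈ ℝ^{J0} with Σ_j x_j a_j = b and ‖x‖₁ ≤ ‖b‖₂ / cos γ0. -/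
open scoped RealInnerProductSpace ENNReal

noncomputable section

/-- The image of the `ℓ¹` unit ball under `x ↦ ∑ j, x j • a j` contains every `u ∈ S` with
`‖u‖ ≤ c`, as soon as every `w ∈ S` satisfies `c * ‖w‖ ≤ |⟪a j, w⟫|` for some `j`. -/
theorem exists_sum_smul_eq_of_norm_le {E ι : Type*} [NormedAddCommGroup E]
    [InnerProductSpace ℝ E] [FiniteDimensional ℝ E] [Fintype ι] {a : ι → E}
    {S : Submodule ℝ E} (haS : ∀ j, a j ∈ S) {c : ℝ}
    (hc : ∀ w ∈ S, ∃ j, c * ‖w‖ ≤ |⟪a j, w⟫|) {u : E} (hu : u ∈ S) (huc : ‖u‖ ≤ c) :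
    ∃ x : ι → ℝ, ∑ j, x j • a j = u ∧ ∑ j, |x j| ≤ 1 := by
  classical
  set B : Set (ι → ℝ) := {x | ∑ j, |x j| ≤ 1} with hB
  have hBconv : Convex ℝ B := by
    intro x hx y hy s t hs ht hst
    have hsum : ∑ j, |(s • x + t • y) j| ≤ ∑ j, (s * |x j| + t * |y j|) := by
      refine Finset.sum_le_sum fun j _ => (abs_add_le _ _).trans_eq ?_
      simp [abs_mul, abs_of_nonneg hs, abs_of_nonneg ht]
    rw [Finset.sum_add_distrib, ← Finset.mul_sum, ← Finset.mul_sum] at hsum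
    simp only [hB, Set.mem_ofPred_eq] at hx hy ⊢
    nlinarith
  have hBcomp : IsCompact B := by
    refine Metric.isCompact_of_isClosed_isBounded
      (isClosed_le (by fun_prop) continuous_const)
      (Metric.isBounded_closedBall (x := (0 : ι → ℝ)) (r := 1) |>.subset fun x hx => ?_)
    rw [mem_closedBall_zero_iff, pi_norm_le_iff_of_nonneg zero_le_one]
    exact fun j => (Finset.single_le_sum (f := fun j => |x j|) (fun i _ => abs_nonneg _)
      (Finset.mem_univ j)).trans hx
  set T : (ι → ℝ) →ₗ[ℝ] E := Fintype.linearCombination ℝ a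
  have hTcont : Continuous T := T.continuous_of_finiteDimensional
  by_contra! hne
  have huT : u ∉ T '' B := by
    rintro ⟨x, hx, rfl⟩
    exact (hne x rfl).not_ge hx
  obtain ⟨f, s, hfs, hsu⟩ := geometric_hahn_banach_closed_point
    (hBconv.linear_image T) (hBcomp.image hTcont).isClosed huT
  set v : E := (InnerProductSpace.toDual ℝ E).symm f
  have hv : ∀ y ∈ S, ⟪S.starProjection v, y⟫ = f y := fun y hy => by
    rw [Submodule.inner_starProjection_left_eq_right,
      Submodule.starProjection_eq_self_iff.2 hy, InnerProductSpace.toDual_symm_apply]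
  obtain ⟨j, hj⟩ := hc _ (S.starProjection_apply_mem v)
  have hpm : ∀ ε : ℝ, |ε| ≤ 1 → ε * f (a j) < s := fun ε hε => by
    have := hfs (T (Pi.single j ε)) ⟨_, ?_, rfl⟩
    · simpa [T] using this
    · simpa [hB, Pi.single_apply, apply_ite abs] using hε
  have habs : |f (a j)| < s :=
    abs_lt.2 ⟨by linarith [hpm (-1) (by simp)], by linarith [hpm 1 (by simp)]⟩
  rw [real_inner_comm, hv _ (haS j)] at hj
  have hfu : f u ≤ ‖S.starProjection v‖ * c := (hv u hu).symm.trans_le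
    ((real_inner_le_norm _ _).trans (by gcongr))
  linarith

/-- A finite spanning family stays uniformly away from orthogonality to every unit vector. -/
theorem exists_pos_le_abs_inner_of_span {E ι : Type*} [NormedAddCommGroup E]
    [InnerProductSpace ℝ E] [FiniteDimensional ℝ E] [Fintype ι] [Nonempty ι] (a : ι → E) :
    ∃ δ > 0, ∀ w ∈ Submodule.span ℝ (Set.range a), ‖w‖ = 1 → ∃ j, δ ≤ |⟪a j, w⟫| := by
  set S := Submodule.span ℝ (Set.range a)
  set K : Set E := Metric.sphere 0 1 ∩ S
  have hK : IsCompact K := (isCompact_sphere 0 1).inter_right S.closed_of_finiteDimensional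
  obtain hK0 | hK0 := K.eq_empty_or_nonempty
  · refine ⟨1, one_pos, fun w hw hw1 => ?_⟩
    exact absurd (show w ∈ K from ⟨by simpa using hw1, hw⟩) (by simp [hK0])
  obtain ⟨w₀, hw₀, hmin⟩ := hK.exists_isMinOn hK0
    (f := fun w => ∑ j, |⟪a j, w⟫|) (by fun_prop)
  have hcard : (0 : ℝ) < Fintype.card ι := by exact_mod_cast Fintype.card_pos
  have hpos : 0 < ∑ j, |⟪a j, w₀⟫| := by
    refine (Finset.sum_nonneg fun j _ => abs_nonneg _).lt_of_ne' fun h0 => ?_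
    have hz : ∀ j, ⟪a j, w₀⟫ = 0 := fun j => abs_eq_zero.1
      ((Finset.sum_eq_zero_iff_of_nonneg fun j _ => abs_nonneg _).1 h0 j (Finset.mem_univ j))
    have hle : S ≤ (ℝ ∙ w₀)ᗮ := Submodule.span_le.2 <| by
      rintro _ ⟨j, rfl⟩
      exact Submodule.mem_orthogonal_singleton_iff_inner_left.2 (hz j)
    have h := Submodule.mem_orthogonal_singleton_iff_inner_left.1 (hle hw₀.2)
    have hw₁ : ‖w₀‖ = 1 := by simpa using hw₀.1
    rw [real_inner_self_eq_norm_sq, hw₁] at h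
    norm_num at h
  refine ⟨(∑ j, |⟪a j, w₀⟫|) / Fintype.card ι, by positivity, fun w hw hw1 => ?_⟩
  by_contra! hlt
  have hsum := Finset.sum_lt_sum_of_nonempty (Finset.univ_nonempty (α := ι)) fun j _ => hlt j
  rw [Finset.sum_const, Finset.card_univ, nsmul_eq_mul, mul_div_cancel₀ _ hcard.ne'] at hsum
  exact hsum.not_ge (hmin (show w ∈ K from ⟨by simpa using hw1, hw⟩))

/-- For a finite family `a` of unit vectors spanning the subspace `S0`, with
covering radius `γ0` of the symmetrized family, every `b ∈ S0` has Basis Pursuit value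
`p(A0, b) ≤ ‖b‖ / cos γ0`; in particular some representation `x` of `b` has
`‖x‖₁ ≤ ‖b‖ / cos γ0`. -/
theorem stmt_10 {D : ℕ} {ι : Type*} [Fintype ι] [Nonempty ι]
    (a : ι → EuclideanSpace ℝ (Fin D))
    (ha : ∀ j, ‖a j‖ = 1)
    (S0 : Submodule ℝ (EuclideanSpace ℝ (Fin D)))
    (hS0 : S0 = Submodule.span ℝ (Set.range a))
    (γ0 : ℝ)
    (hγ0 : γ0 = sSup {θ : ℝ | ∃ w ∈ S0, ‖w‖ = 1 ∧ θ = ⨅ j, Real.arccos |⟪a j, w⟫|}) :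
    ∀ b ∈ S0,
      sInf ((fun x : ι → ℝ => ENNReal.ofReal (∑ j, |x j|)) ''
          {x | ∑ j, x j • a j = b}) ≤ ENNReal.ofReal (‖b‖ / Real.cos γ0) ∧
      ∃ x : ι → ℝ, ∑ j, x j • a j = b ∧ ∑ j, |x j| ≤ ‖b‖ / Real.cos γ0 := by
  have haS : ∀ j, a j ∈ S0 := fun j => hS0 ▸ Submodule.subset_span ⟨j, rfl⟩
  obtain ⟨δ, hδ, hδw⟩ := exists_pos_le_abs_inner_of_span a
  rw [← hS0] at hδw
  set Θ : Set ℝ := {θ : ℝ | ∃ w ∈ S0, ‖w‖ = 1 ∧ θ = ⨅ j, Real.arccos |⟪a j, w⟫|}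
  have hle : ∀ θ ∈ Θ, θ ≤ Real.arccos δ := by
    rintro _ ⟨w, hw, hw1, rfl⟩
    obtain ⟨j, hj⟩ := hδw w hw hw1
    exact (ciInf_le (Set.finite_range _).bddBelow j).trans (Real.arccos_le_arccos hj)
  have hγδ : γ0 ≤ Real.arccos δ := by
    obtain ⟨j⟩ := ‹Nonempty ι›
    exact hγ0 ▸ csSup_le ⟨_, a j, haS j, ha j, rfl⟩ hle
  have hγlt : γ0 < Real.pi / 2 := hγδ.trans_lt (Real.arccos_lt_pi_div_two.2 hδ)
  have hγnonneg : 0 ≤ γ0 := by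
    rw [hγ0]
    refine Real.sSup_nonneg ?_
    rintro _ ⟨w, -, -, rfl⟩
    exact Real.iInf_nonneg fun j => Real.arccos_nonneg _
  have hcos : 0 < Real.cos γ0 := Real.cos_pos_of_mem_Ioo ⟨by linarith, hγlt⟩
  have hunit : ∀ w ∈ S0, ‖w‖ = 1 → ∃ j, Real.cos γ0 ≤ |⟪a j, w⟫| := by
    intro w hw hw1
    obtain ⟨j, hj⟩ := exists_eq_ciInf_of_finite (f := fun j => Real.arccos |⟪a j, w⟫|)
    have hjγ : Real.arccos |⟪a j, w⟫| ≤ γ0 := by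
      rw [hγ0]
      exact le_csSup ⟨_, hle⟩ ⟨w, hw, hw1, hj⟩
    refine ⟨j, ?_⟩
    have habs : |⟪a j, w⟫| ≤ 1 := by simpa [ha j, hw1] using abs_real_inner_le_norm (a j) w
    rw [← Real.cos_arccos (by linarith [abs_nonneg ⟪a j, w⟫]) habs]
    exact Real.cos_le_cos_of_nonneg_of_le_pi (Real.arccos_nonneg _)
      (by linarith [Real.pi_pos]) hjγ
  have hall : ∀ w ∈ S0, ∃ j, Real.cos γ0 * ‖w‖ ≤ |⟪a j, w⟫| := by
    intro w hw
    rcases eq_or_ne w 0 with rfl | hw0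
    · simp
    obtain ⟨j, hj⟩ := hunit (‖w‖⁻¹ • w) (S0.smul_mem _ hw) (norm_smul_inv_norm hw0)
    refine ⟨j, ?_⟩
    rwa [inner_smul_right, abs_mul, abs_of_nonneg (by positivity),
      le_inv_mul_iff₀ (norm_pos_iff.2 hw0), mul_comm] at hj
  intro b hb
  have hex : ∃ x : ι → ℝ, ∑ j, x j • a j = b ∧ ∑ j, |x j| ≤ ‖b‖ / Real.cos γ0 := by
    rcases eq_or_ne b 0 with rfl | hb0
    · exact ⟨0, by simp⟩
    have hbpos := norm_pos_iff.2 hb0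
    set r := ‖b‖ / Real.cos γ0 with hr
    have hrpos : 0 < r := by positivity
    obtain ⟨x, hx, hx1⟩ := exists_sum_smul_eq_of_norm_le haS hall (S0.smul_mem r⁻¹ hb) (by
      rw [norm_smul, norm_inv, Real.norm_of_nonneg hrpos.le, hr]
      field_simp
      exact le_rfl)
    refine ⟨r • x, ?_, ?_⟩
    · simp only [Pi.smul_apply, smul_assoc, ← Finset.smul_sum, hx]
      exact smul_inv_smul₀ hrpos.ne' b
    · simp only [Pi.smul_apply, smul_eq_mul, abs_mul, abs_of_pos hrpos, ← Finset.mul_sum]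
      exact mul_le_of_le_one_right hrpos.le hx1
  refine ⟨?_, hex⟩
  obtain ⟨x, hx, hxr⟩ := hex
  exact le_trans (sInf_le (by exact ⟨x, hx, rfl⟩)) (ENNReal.ofReal_le_ofReal hxr)
end
end

section
/- Let Ac = {a_j : j ∈ Jc} be a finite set of unit vectors in ℝ^D and S0 a nonzero linear subspace of ℝ^D. Then for every b ∈ S0 and every x ∈ ℝ^{Jc} with Σ_j x_j a_j = b, one has ‖b‖₂ ≤ cos(s(Ac, S0)) · ‖x‖₁; consequently, if cos(s(Ac, S0)) > 0 then p(Ac, b) ≥ ‖b‖₂ / cos(s(Ac, S0)). -/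
open scoped RealInnerProductSpace ENNReal

noncomputable section

/-- Every atom of a unit family has correlation at most `cos s` with the points of a subspace,
where `s` is the spherical distance between the family and the subspace. -/
theorem abs_inner_le_cos_sInf_mul_norm {E ι : Type*} [NormedAddCommGroup E]
    [InnerProductSpace ℝ E] (a : ι → E) (ha : ∀ j, ‖a j‖ = 1) (S : Submodule ℝ E)
    (j : ι) {w : E} (hw : w ∈ S) :
    |⟪a j, w⟫| ≤ Real.cos (sInf {θ : ℝ | ∃ j : ι, ∃ w ∈ S, w ≠ 0 ∧
      θ = Real.arccos (⟪a j, w⟫ / (‖a j‖ * ‖w‖))}) * ‖w‖ := by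
  set T := {θ : ℝ | ∃ j : ι, ∃ w ∈ S, w ≠ 0 ∧
    θ = Real.arccos (⟪a j, w⟫ / (‖a j‖ * ‖w‖))}
  have hT : ∀ θ ∈ T, 0 ≤ θ := by
    rintro θ ⟨j, w, -, -, rfl⟩
    exact Real.arccos_nonneg _
  have key : ∀ v ∈ S, ⟪a j, v⟫ ≤ Real.cos (sInf T) * ‖v‖ := by
    intro v hv
    rcases eq_or_ne v 0 with rfl | hv0
    · simp
    have hle : sInf T ≤ Real.arccos (⟪a j, v⟫ / (‖a j‖ * ‖v‖)) :=
      csInf_le ⟨0, hT⟩ ⟨j, v, hv, hv0, rfl⟩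
    have hcos := Real.cos_le_cos_of_nonneg_of_le_pi (Real.sInf_nonneg hT)
      (Real.arccos_le_pi _) hle
    have habs := abs_le.1 (abs_real_inner_div_norm_mul_norm_le_one (a j) v)
    rwa [Real.cos_arccos habs.1 habs.2, ha j, one_mul,
      div_le_iff₀ (norm_pos_iff.2 hv0)] at hcos
  refine abs_le'.2 ⟨key w hw, ?_⟩
  simpa using key (-w) (S.neg_mem hw)

/-- Let `Ac = (ac j)` be a finite family of unit vectors and `S0` a nonzero
linear subspace of `ℝ^D`. For every `b ∈ S0` and every representation
`b = ∑ j, x j • ac j`, one has `‖b‖ ≤ cos (s(Ac, S0)) * ‖x‖₁`, where `s(Ac, S0)` is the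
infimum of the spherical distances between atoms of `Ac` and nonzero points of `S0`;
consequently, if `cos (s(Ac, S0)) > 0`, then `p(Ac, b) ≥ ‖b‖ / cos (s(Ac, S0))`. -/
theorem stmt_11 {D : ℕ} {ιc : Type*} [Fintype ιc]
    (ac : ιc → EuclideanSpace ℝ (Fin D))
    (hac : ∀ j, ‖ac j‖ = 1)
    (S0 : Submodule ℝ (EuclideanSpace ℝ (Fin D)))
    (hS0 : S0 ≠ ⊥)
    (sAcS0 : ℝ)
    (hs : sAcS0 = sInf {θ : ℝ | ∃ j : ιc, ∃ w ∈ S0, w ≠ 0 ∧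
        θ = Real.arccos (⟪ac j, w⟫ / (‖ac j‖ * ‖w‖))}) :
    ∀ b ∈ S0,
      (∀ x : ιc → ℝ, ∑ j, x j • ac j = b →
        ‖b‖ ≤ Real.cos sAcS0 * ∑ j, |x j|) ∧
      (0 < Real.cos sAcS0 →
        ENNReal.ofReal (‖b‖ / Real.cos sAcS0) ≤
          sInf ((fun x : ιc → ℝ => ENNReal.ofReal (∑ j, |x j|)) ''
            {x | ∑ j, x j • ac j = b})) := by
  subst hs
  intro b hb
  have hcorr := fun j {w} (hw : w ∈ S0) => abs_inner_le_cos_sInf_mul_norm ac hac S0 j hw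
  set c := Real.cos (sInf {θ : ℝ | ∃ j : ιc, ∃ w ∈ S0, w ≠ 0 ∧
    θ = Real.arccos (⟪ac j, w⟫ / (‖ac j‖ * ‖w‖))})
  have hbound : ∀ x : ιc → ℝ, ∑ j, x j • ac j = b → ‖b‖ ≤ c * ∑ j, |x j| := by
    intro x hx
    rcases eq_or_ne b 0 with rfl | hb0
    · obtain ⟨w, hw, hw0⟩ := S0.ne_bot_iff.1 hS0
      rw [norm_zero, Finset.mul_sum]
      refine Finset.sum_nonneg fun j _ => mul_nonneg ?_ (abs_nonneg _)
      exact nonneg_of_mul_nonneg_left ((abs_nonneg _).trans (hcorr j hw)) (norm_pos_iff.2 hw0)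
    · refine le_of_mul_le_mul_right ?_ (norm_pos_iff.2 hb0)
      calc ‖b‖ * ‖b‖ = ⟪∑ j, x j • ac j, b⟫ := by rw [hx, real_inner_self_eq_norm_mul_norm]
        _ = ∑ j, x j * ⟪ac j, b⟫ := by simp only [sum_inner, real_inner_smul_left]
        _ ≤ ∑ j, |x j| * (c * ‖b‖) := Finset.sum_le_sum fun j _ =>
            (le_abs_self _).trans <| (abs_mul _ _).le.trans <|
              mul_le_mul_of_nonneg_left (hcorr j hb) (abs_nonneg _)
        _ = c * (∑ j, |x j|) * ‖b‖ := by rw [← Finset.sum_mul]; ring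
  refine ⟨hbound, fun hc => le_sInf ?_⟩
  rintro _ ⟨x, hx, rfl⟩
  exact ENNReal.ofReal_le_ofReal ((div_le_iff₀' hc).2 (hbound x hx))
end
end

section
/- For every integer p ≥ 2, every unit vector w ∈ ℝ^p, and every θ ∈ [0, π/2], the normalized area of the spherical cap S^{p−1}_θ(w) = {v ∈ S^{p−1} : arccos⟨w, v⟩ ≤ θ} satisfies (v_{p−1}/(p·v_p))·sin^{p−1}θ ≤ σ_{p−1}(S^{p−1}_θ(w))/σ_{p−1}(S^{p−1}) ≤ (v_{p−1}/v_p)·sin^{p−1}θ. -/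
open scoped RealInnerProductSpace ENNReal
open MeasureTheory

noncomputable section

/-- `vball p` is the Lebesgue volume `v_p = π^(p/2) / Γ(p/2 + 1)` of the unit ball of
`ℝ^p`. -/
def vball (p : ℕ) : ℝ := Real.pi ^ ((p : ℝ) / 2) / Real.Gamma ((p : ℝ) / 2 + 1)

open Filter Topology Metric Set Module

section UniformlyDistributed

variable {X : Type*} [PseudoMetricSpace X] [SecondCountableTopology X] [MeasurableSpace X]
  [BorelSpace X]

theorem measure_isOpen_le_liminf_of_ball_eq (μ ν : Measure X) [IsFiniteMeasure μ]
    [IsFiniteMeasure ν] [ν.IsOpenPosMeasure]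
    (hμ : ∀ x y r, μ (ball x r) = μ (ball y r)) (hν : ∀ x y r, ν (ball x r) = ν (ball y r))
    (x₀ : X) {r : ℕ → ℝ} (hr0 : ∀ k, 0 < r k) (hr : Tendsto r atTop (𝓝 0))
    {U : Set X} (hU : IsOpen U) :
    μ U ≤ liminf (fun k => μ (ball x₀ (r k)) / ν (ball x₀ (r k)) * ν U) atTop := by
  have hopen : ∀ k, IsOpen {q : X × X | dist q.2 q.1 < r k} := fun k =>
    isOpen_lt (by fun_prop) (by fun_prop)
  have hmeas : ∀ k, Measurable fun x => (ν.restrict U) (ball x (r k)) := fun k =>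
    measurable_measure_prodMk_left (hopen k).measurableSet
  calc μ U = ∫⁻ _ in U, 1 ∂μ := by simp
    _ ≤ ∫⁻ x in U, liminf (fun k => (ν (ball x₀ (r k)))⁻¹ * (ν.restrict U) (ball x (r k)))
          atTop ∂μ := by
        refine setLIntegral_mono' hU.measurableSet fun x hx => ?_
        refine le_liminf_of_le (h := ?_)
        obtain ⟨ε, hε, hball⟩ := Metric.isOpen_iff.1 hU x hx
        filter_upwards [hr.eventually_lt_const hε] with k hk
        rw [Measure.restrict_apply measurableSet_ball,
          inter_eq_left.2 ((ball_subset_ball hk.le).trans hball), hν x x₀,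
          ENNReal.inv_mul_cancel (isOpen_ball.measure_ne_zero ν (nonempty_ball.2 (hr0 k)))
            (measure_ne_top _ _)]
    _ ≤ liminf (fun k => ∫⁻ x in U, (ν (ball x₀ (r k)))⁻¹ * (ν.restrict U) (ball x (r k)) ∂μ)
          atTop := lintegral_liminf_le fun k => (hmeas k).const_mul _
    _ ≤ _ := by
        refine liminf_le_liminf (Eventually.of_forall fun k => ?_)
        have key : ∫⁻ x in U, (ν.restrict U) (ball x (r k)) ∂μ
            = ∫⁻ y in U, (μ.restrict U) (ball y (r k)) ∂ν := by
          have h1 := Measure.prod_apply (μ := μ.restrict U) (ν := ν.restrict U)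
            (hopen k).measurableSet
          have h2 := Measure.prod_apply_symm (μ := μ.restrict U) (ν := ν.restrict U)
            (hopen k).measurableSet
          rw [h1] at h2
          convert! h2 using 4
          ext z
          simp [dist_comm]
        rw [lintegral_const_mul _ (hmeas k), key, div_eq_mul_inv, mul_comm (μ _), mul_assoc]
        gcongr
        calc ∫⁻ y in U, (μ.restrict U) (ball y (r k)) ∂ν
            ≤ ∫⁻ _ in U, μ (ball x₀ (r k)) ∂ν := by
              refine lintegral_mono fun y => ?_
              rw [← hμ y x₀]
              exact Measure.restrict_apply_le _ _
          _ = _ := by simp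

/-- Two uniformly distributed finite measures on a metric space are proportional. -/
theorem measure_univ_smul_eq_of_ball_eq (μ ν : Measure X) [IsFiniteMeasure μ]
    [IsFiniteMeasure ν] [μ.IsOpenPosMeasure] [ν.IsOpenPosMeasure]
    (hμ : ∀ x y r, μ (ball x r) = μ (ball y r)) (hν : ∀ x y r, ν (ball x r) = ν (ball y r)) :
    ν univ • μ = μ univ • ν := by
  rcases isEmpty_or_nonempty X with hX | ⟨⟨x₀⟩⟩
  · exact Subsingleton.elim _ _
  obtain ⟨r, -, hr0, hr⟩ := exists_seq_strictAnti_tendsto (0 : ℝ)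
  have key : ∀ U V : Set X, IsOpen U → IsOpen V → μ U * ν V ≤ μ V * ν U := by
    intro U V hU hV
    refine (mul_le_mul' (measure_isOpen_le_liminf_of_ball_eq μ ν hμ hν x₀ hr0 hr hU)
      (measure_isOpen_le_liminf_of_ball_eq ν μ hν hμ x₀ hr0 hr hV)).trans ?_
    refine ENNReal.le_liminf_mul.trans (le_of_eq ?_)
    refine (congrArg (liminf · atTop) (funext fun k => ?_)).trans (liminf_const (μ V * ν U))
    have h1 := isOpen_ball.measure_ne_zero μ (nonempty_ball.2 (hr0 k) : (ball x₀ (r k)).Nonempty)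
    have h2 := isOpen_ball.measure_ne_zero ν (nonempty_ball.2 (hr0 k) : (ball x₀ (r k)).Nonempty)
    have h3 := measure_ne_top μ (ball x₀ (r k))
    have h4 := measure_ne_top ν (ball x₀ (r k))
    simp only [Pi.mul_apply, div_eq_mul_inv]
    calc _ = (μ (ball x₀ (r k)) * (μ (ball x₀ (r k)))⁻¹) *
          (ν (ball x₀ (r k)) * (ν (ball x₀ (r k)))⁻¹) * (μ V * ν U) := by ring
      _ = _ := by rw [ENNReal.mul_inv_cancel h1 h3, ENNReal.mul_inv_cancel h2 h4]; simp
  have : IsFiniteMeasure (ν univ • μ) := Measure.smul_finite _ (measure_ne_top _ _)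
  refine ext_of_generate_finite _ (BorelSpace.measurable_eq (α := X)) isPiSystem_isOpen
    (fun U hU => ?_) (by simp [mul_comm])
  simp only [Measure.smul_apply, smul_eq_mul]
  apply le_antisymm
  · simpa [mul_comm] using key U univ hU isOpen_univ
  · simpa [mul_comm] using key univ U isOpen_univ hU

end UniformlyDistributed

theorem isOpenPosMeasure_of_ball_eq {X : Type*} [PseudoMetricSpace X] [SecondCountableTopology X]
    [MeasurableSpace X] (μ : Measure X) (h0 : μ univ ≠ 0)
    (hμ : ∀ x y r, μ (ball x r) = μ (ball y r)) : μ.IsOpenPosMeasure where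
  open_pos U hU := by
    rintro ⟨x, hx⟩ h
    obtain ⟨ε, hε, hball⟩ := Metric.isOpen_iff.1 hU x hx
    exact h0 (measure_null_of_locally_null _ fun y _ => ⟨ball y ε,
      mem_nhdsWithin_of_mem_nhds (ball_mem_nhds y hε),
      (hμ y x ε).trans (measure_mono_null hball h)⟩)

theorem hausdorffMeasure_image_coe_sphere {E : Type*} [NormedAddCommGroup E]
    [MeasurableSpace E] [BorelSpace E] {d : ℝ} (hd : 0 ≤ d) (s : Set (sphere (0 : E) 1)) :
    μH[d] ((↑) '' s : Set E) = μH[d] s :=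
  isometry_subtype_coe.hausdorffMeasure_image (Or.inl hd) s

section Sphere

open scoped Pointwise

variable {E : Type*} [NormedAddCommGroup E] [InnerProductSpace ℝ E]

theorem exists_linearIsometryEquiv_image_ball_sphere (x y : sphere (0 : E) 1) :
    ∃ R : E ≃ₗᵢ[ℝ] E, ∀ r, ((↑) '' ball y r : Set E) = R '' ((↑) '' ball x r) := by
  refine ⟨(ℝ ∙ ((x : E) - y))ᗮ.reflection, fun r => ?_⟩
  have hxy : (ℝ ∙ ((x : E) - y))ᗮ.reflection x = y := Submodule.reflection_sub (by simp)
  have h : ∀ z : sphere (0 : E) 1, ((↑) '' ball z r : Set E) = ball (z : E) r ∩ sphere 0 1 := by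
    intro z
    ext v
    simp
  rw [h, h, image_inter (LinearIsometryEquiv.injective _), LinearIsometryEquiv.image_ball,
    LinearIsometryEquiv.image_sphere, hxy, map_zero]

variable [MeasurableSpace E] [BorelSpace E]

theorem hausdorffMeasure_ball_sphere_eq {d : ℝ} (hd : 0 ≤ d) (x y : sphere (0 : E) 1) (r : ℝ) :
    μH[d] (ball x r) = μH[d] (ball y r) := by
  obtain ⟨R, hR⟩ := exists_linearIsometryEquiv_image_ball_sphere x y
  rw [← hausdorffMeasure_image_coe_sphere hd, ← hausdorffMeasure_image_coe_sphere hd, hR,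
    R.isometry.hausdorffMeasure_image (Or.inl hd)]

variable [FiniteDimensional ℝ E]

theorem toSphere_ball_eq (x y : sphere (0 : E) 1) (r : ℝ) :
    (volume : Measure E).toSphere (ball x r) = (volume : Measure E).toSphere (ball y r) := by
  obtain ⟨R, hR⟩ := exists_linearIsometryEquiv_image_ball_sphere x y
  rw [Measure.toSphere_apply' _ measurableSet_ball, Measure.toSphere_apply' _ measurableSet_ball,
    hR]
  have : Ioo (0 : ℝ) 1 • (R '' ((↑) '' ball x r)) =
      R '' (Ioo (0 : ℝ) 1 • ((↑) '' ball x r : Set E)) := by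
    simp only [← image2_smul]
    rw [image_image2_distrib_right fun a b => R.map_smul a b]
  rw [this, ← R.coe_toMeasurableEquiv, ← MeasurableEquiv.preimage_symm,
    MeasurePreserving.measure_preimage_equiv]
  exact R.symm.measurePreserving

variable {n : ℕ} [Fact (finrank ℝ E = n + 1)]

instance isFiniteMeasure_hausdorffMeasure_sphere :
    IsFiniteMeasure (μH[(n : ℝ)] : Measure (sphere (0 : E) 1)) where
  measure_univ_lt_top := by
    refine isCompact_univ.measure_lt_top_of_nhdsWithin fun x _ => ?_
    rw [nhdsWithin_univ]
    have hv : ‖-(x : E)‖ = 1 := by simp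
    have hrank : finrank ℝ (ℝ ∙ (-(x : E)))ᗮ = n :=
      Submodule.finrank_orthogonal_span_singleton (by rw [← norm_ne_zero_iff, hv]; simp)
    have hx : stereoInvFun hv 0 = x := by
      ext
      simp
    have hsmooth : ContDiff ℝ 1 fun w : (ℝ ∙ (-(x : E)))ᗮ => (stereoInvFun hv w : E) :=
      contDiff_stereoInvFunAux.comp (ℝ ∙ (-(x : E)))ᗮ.subtypeL.contDiff
    obtain ⟨K, t, ht, hK⟩ := (hsmooth.contDiffAt (x := 0)).exists_lipschitzOnWith
    have hK' : LipschitzOnWith K (stereoInvFun hv) (t ∩ closedBall 0 1) :=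
      fun a ha b hb => hK ha.1 hb.1
    refine ⟨stereoInvFun hv '' (t ∩ closedBall 0 1), ?_, ?_⟩
    · have := (isOpenEmbedding_stereographic_symm hv).isOpenMap.image_mem_nhds
        (x := 0) (inter_mem ht (closedBall_mem_nhds 0 one_pos))
      rwa [show (stereographic hv).symm 0 = x from hx] at this
    · refine (hK'.hausdorffMeasure_image_le (Nat.cast_nonneg n)).trans_lt ?_
      refine ENNReal.mul_lt_top (by simp) ?_
      refine (measure_mono inter_subset_right).trans_lt ?_
      have := (isCompact_closedBall (0 : (ℝ ∙ (-(x : E)))ᗮ) 1).measure_lt_top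
        (μ := μH[finrank ℝ (ℝ ∙ (-(x : E)))ᗮ])
      rwa [hrank] at this

theorem hausdorffMeasure_sphere_ne_zero :
    (μH[(n : ℝ)] : Measure (sphere (0 : E) 1)) univ ≠ 0 := by
  have : Nontrivial E := Module.nontrivial_of_finrank_pos (R := ℝ)
    (by rw [Fact.out (p := finrank ℝ E = n + 1)]; omega)
  obtain ⟨w, hw⟩ := exists_norm_eq E zero_le_one
  have hrank : finrank ℝ (ℝ ∙ w)ᗮ = n :=
    Submodule.finrank_orthogonal_span_singleton (by rw [← norm_ne_zero_iff, hw]; simp)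
  rw [← hausdorffMeasure_image_coe_sphere (Nat.cast_nonneg n), image_univ, Subtype.range_coe]
  have hsub : ball 0 1 ⊆ (ℝ ∙ w)ᗮ.orthogonalProjectionOnto '' sphere (0 : E) 1 := by
    intro x hx
    have hx1 : ‖x‖ < 1 := by simpa using hx
    have hort : ⟪w, (x : E)⟫ = 0 := Submodule.mem_orthogonal_singleton_iff_inner_right.1 x.2
    refine ⟨√(1 - ‖x‖ ^ 2) • w + x, ?_, ?_⟩
    · have h2 : ‖√(1 - ‖x‖ ^ 2) • w + (x : E)‖ ^ 2 = 1 := by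
        rw [norm_add_sq_real, inner_smul_left, hort, norm_smul, hw, mul_one, Real.norm_eq_abs,
          sq_abs, Real.sq_sqrt (by nlinarith [norm_nonneg x])]
        simp
      simpa using (pow_eq_one_iff_of_nonneg (norm_nonneg _) two_ne_zero).1 h2
    · rw [map_add, map_smul,
        Submodule.orthogonalProjectionOnto_orthogonal_apply_eq_zero
          (Submodule.mem_span_singleton_self w)]
      simp
  refine ((pos_iff_ne_zero.2 ?_).trans_le <| (measure_mono hsub).trans
    (hausdorffMeasure_orthogonalProjectionOnto_le _ n _ (Nat.cast_nonneg n))).ne'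
  have := isOpen_ball.measure_ne_zero (μH[finrank ℝ (ℝ ∙ w)ᗮ])
    (nonempty_ball.2 one_pos : (ball (0 : (ℝ ∙ w)ᗮ) 1).Nonempty)
  rwa [hrank] at this

/-- The normalized Hausdorff measure on the unit sphere agrees with the normalized volume of the
sectors over its subsets. -/
theorem hausdorffMeasure_sphere_div_eq {s : Set E} (hs : s ⊆ sphere 0 1) (hm : MeasurableSet s) :
    μH[(n : ℝ)] s / μH[(n : ℝ)] (sphere (0 : E) 1) =
      volume (Ioo (0 : ℝ) 1 • s) / volume (ball (0 : E) 1) := by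
  have hfin : finrank ℝ E = n + 1 := Fact.out
  have : Nontrivial E := Module.nontrivial_of_finrank_pos (R := ℝ) (by omega)
  have : (μH[(n : ℝ)] : Measure (sphere (0 : E) 1)).IsOpenPosMeasure :=
    isOpenPosMeasure_of_ball_eq _ hausdorffMeasure_sphere_ne_zero
      (hausdorffMeasure_ball_sphere_eq (Nat.cast_nonneg n))
  have h := measure_univ_smul_eq_of_ball_eq (μH[(n : ℝ)] : Measure (sphere (0 : E) 1))
    (volume : Measure E).toSphere (hausdorffMeasure_ball_sphere_eq (Nat.cast_nonneg n))
    toSphere_ball_eq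
  have hs' : ((↑) '' ((↑) ⁻¹' s : Set (sphere (0 : E) 1)) : Set E) = s := by
    rw [Subtype.image_preimage_coe, inter_eq_right.2 hs]
  have h1 := congrArg (fun m => m ((↑) ⁻¹' s : Set (sphere (0 : E) 1))) h
  have huniv := hausdorffMeasure_image_coe_sphere (E := E) (Nat.cast_nonneg (α := ℝ) n) univ
  rw [image_univ, Subtype.range_coe] at huniv
  simp only [Measure.smul_apply, smul_eq_mul, Measure.toSphere_apply_univ,
    Measure.toSphere_apply' _ (measurable_subtype_coe hm), hs',
    ← hausdorffMeasure_image_coe_sphere (E := E) (Nat.cast_nonneg (α := ℝ) n)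
      ((↑) ⁻¹' s : Set (sphere (0 : E) 1)), ← huniv] at h1
  have hd0 : (finrank ℝ E : ℝ≥0∞) ≠ 0 := by simp [hfin]
  have hd1 : (finrank ℝ E : ℝ≥0∞) ≠ ⊤ := by simp
  have hb0 : volume (ball (0 : E) 1) ≠ 0 :=
    isOpen_ball.measure_ne_zero _ (nonempty_ball.2 one_pos)
  have hb1 : volume (ball (0 : E) 1) ≠ ⊤ := measure_ball_lt_top.ne
  have ht0 : μH[(n : ℝ)] (sphere (0 : E) 1) ≠ 0 := huniv ▸ hausdorffMeasure_sphere_ne_zero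
  have ht1 : μH[(n : ℝ)] (sphere (0 : E) 1) ≠ ⊤ := huniv ▸ measure_ne_top _ _
  rw [ENNReal.div_eq_div_iff hb0 hb1 ht0 ht1]
  rw [mul_assoc, mul_left_comm (μH[(n : ℝ)] (sphere (0 : E) 1)),
    ENNReal.mul_right_inj hd0 hd1] at h1
  exact h1

end Sphere

section Sector

open scoped Pointwise

variable {E : Type*} [NormedAddCommGroup E] [InnerProductSpace ℝ E]

/-- The open unit ball intersected with the cone `c * ‖z‖ ≤ ⟪w, z⟫`, without its apex. -/
def capSector (w : E) (c : ℝ) : Set E := {z | z ≠ 0 ∧ ‖z‖ < 1 ∧ c * ‖z‖ ≤ ⟪w, z⟫}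

theorem sphericalCap_eq {w : E} (hw : ‖w‖ = 1) {θ : ℝ} (hθ : θ ∈ Icc 0 (Real.pi / 2)) :
    {v | v ∈ sphere (0 : E) 1 ∧ Real.arccos ⟪w, v⟫ ≤ θ} =
      sphere 0 1 ∩ {v | Real.cos θ ≤ ⟪w, v⟫} := by
  ext v
  simp only [mem_inter_iff, mem_ofPred_eq]
  refine and_congr_right fun hv => ?_
  have hv1 : ‖v‖ = 1 := by simpa using hv
  have habs : |⟪w, v⟫| ≤ 1 := by simpa [hw, hv1] using abs_real_inner_le_norm w v
  obtain ⟨h1, h2⟩ := abs_le.1 habs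
  have hθ' : θ ∈ Icc 0 Real.pi := ⟨hθ.1, hθ.2.trans (by linarith [Real.pi_pos])⟩
  rw [← Real.strictAntiOn_cos.le_iff_ge hθ' ⟨Real.arccos_nonneg _, Real.arccos_le_pi _⟩,
    Real.cos_arccos h1 h2]

theorem Ioo_smul_sphericalCap (w : E) (c : ℝ) :
    Ioo (0 : ℝ) 1 • (sphere 0 1 ∩ {v | c ≤ ⟪w, v⟫}) = capSector w c := by
  ext z
  simp only [Set.mem_smul, mem_inter_iff, mem_sphere_iff_norm, sub_zero, mem_ofPred_eq, capSector]
  constructor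
  · rintro ⟨r, hr, v, ⟨hv, hc⟩, rfl⟩
    have hv0 : v ≠ 0 := by rintro rfl; simp at hv
    refine ⟨smul_ne_zero hr.1.ne' hv0, ?_, ?_⟩
    · simp [norm_smul, hv, abs_of_pos hr.1, hr.2]
    · rw [norm_smul, hv, inner_smul_right, Real.norm_eq_abs, abs_of_pos hr.1, mul_one, mul_comm]
      exact mul_le_mul_of_nonneg_left hc hr.1.le
  · rintro ⟨h0, h1, hc⟩
    have hz : 0 < ‖z‖ := norm_pos_iff.2 h0
    refine ⟨‖z‖, ⟨hz, h1⟩, ‖z‖⁻¹ • z, ⟨?_, ?_⟩, ?_⟩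
    · simp [norm_smul, hz.ne']
    · rwa [inner_smul_right, le_inv_mul_iff₀ hz, mul_comm]
    · rw [smul_smul, mul_inv_cancel₀ hz.ne', one_smul]

theorem inner_smul_add_orthogonal {w : E} (hw : ‖w‖ = 1) (t : ℝ) (x : (ℝ ∙ w)ᗮ) :
    ⟪w, t • w + (x : E)⟫ = t := by
  have hort : ⟪w, (x : E)⟫ = 0 := Submodule.mem_orthogonal_singleton_iff_inner_right.1 x.2
  simp [inner_add_right, inner_smul_right, hort, hw]

theorem norm_smul_add_orthogonal_sq {w : E} (hw : ‖w‖ = 1) (t : ℝ) (x : (ℝ ∙ w)ᗮ) :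
    ‖t • w + (x : E)‖ ^ 2 = t ^ 2 + ‖x‖ ^ 2 := by
  have hort : ⟪w, (x : E)⟫ = 0 := Submodule.mem_orthogonal_singleton_iff_inner_right.1 x.2
  rw [norm_add_sq_real, inner_smul_left, hort, norm_smul, hw]
  simp

variable [MeasurableSpace E] [BorelSpace E]

theorem measurableSet_capSector (w : E) (c : ℝ) : MeasurableSet (capSector w c) := by
  refine ((measurableSet_singleton (0 : E)).compl).inter (MeasurableSet.inter ?_ ?_)
  · exact (isOpen_lt continuous_norm continuous_const).measurableSet
  · exact (isClosed_le (continuous_const.mul continuous_norm)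
      (continuous_const.inner continuous_id)).measurableSet

variable [FiniteDimensional ℝ E]

theorem measurePreserving_smul_add_orthogonal {w : E} (hw : ‖w‖ = 1) :
    MeasurePreserving (fun q : ℝ × (ℝ ∙ w)ᗮ => q.1 • w + (q.2 : E)) := by
  have h1 : MeasurePreserving (LinearIsometryEquiv.toSpanUnitSingleton (𝕜 := ℝ) w hw) :=
    LinearIsometryEquiv.measurePreserving _
  have h2 := ((ℝ ∙ w).orthogonalDecomposition.symm.measurePreserving.comp
    (WithLp.volume_preserving_toLp (ℝ ∙ w) (ℝ ∙ w)ᗮ)).comp (h1.prod (.id volume))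
  convert! h2 using 1

theorem volume_capSector_le {w : E} (hw : ‖w‖ = 1) {c s : ℝ} (hc : 0 ≤ c) (hs : 0 ≤ s)
    (hcs : s ^ 2 + c ^ 2 = 1) :
    volume (capSector w c) ≤ volume (closedBall (0 : (ℝ ∙ w)ᗮ) s) := by
  rw [← (measurePreserving_smul_add_orthogonal hw).measure_preimage
    (measurableSet_capSector w c).nullMeasurableSet]
  have hsub : (fun q : ℝ × (ℝ ∙ w)ᗮ => q.1 • w + (q.2 : E)) ⁻¹' capSector w c ⊆
      Icc 0 1 ×ˢ closedBall 0 s := by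
    rintro ⟨t, x⟩ ⟨-, h1, h2⟩
    rw [inner_smul_add_orthogonal hw] at h2
    have h3 := norm_smul_add_orthogonal_sq hw t x
    simp only at h1 h2
    set N := ‖t • w + (x : E)‖
    have hN : 0 ≤ N := norm_nonneg _
    have ht : 0 ≤ t := (mul_nonneg hc hN).trans h2
    have hcN : (c * N) ^ 2 ≤ t ^ 2 := pow_le_pow_left₀ (mul_nonneg hc hN) h2 2
    have hN1 : N ^ 2 ≤ 1 := by nlinarith
    refine ⟨⟨ht, by nlinarith [norm_nonneg x]⟩, ?_⟩
    rw [mem_closedBall_zero_iff]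
    refine abs_le_of_sq_le_sq' ?_ hs |>.2
    nlinarith [sq_nonneg s]
  refine (measure_mono hsub).trans ?_
  rw [Measure.volume_eq_prod, Measure.prod_prod]
  simp

theorem lintegral_ball_radius_le_volume_capSector {w : E} (hw : ‖w‖ = 1) {c s : ℝ} (hc : 0 ≤ c)
    (hs : 0 < s) (hcs : s ^ 2 + c ^ 2 = 1) :
    (∫⁻ t in Ioo 0 c, volume (ball (0 : (ℝ ∙ w)ᗮ) (s * (t / c)))) +
      (∫⁻ t in Ioo c 1, volume (ball (0 : (ℝ ∙ w)ᗮ) (s * ((1 - t) / (1 - c))))) ≤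
      volume (capSector w c) := by
  have hc1 : c < 1 := by nlinarith
  have hmem : ∀ (t ρ : ℝ), 0 < t → t ^ 2 + ρ ^ 2 ≤ 1 → c * ρ ≤ s * t →
      ball (0 : (ℝ ∙ w)ᗮ) ρ ⊆ {x | t • w + (x : E) ∈ capSector w c} := by
    intro t ρ ht h1 h2 x hx
    rw [mem_ball_zero_iff] at hx
    have h3 := norm_smul_add_orthogonal_sq hw t x
    have hxn := norm_nonneg x
    have hN := norm_nonneg (t • w + (x : E))
    refine ⟨fun h => ?_, ?_, ?_⟩
    · rw [h, norm_zero] at h3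
      nlinarith
    · refine lt_of_pow_lt_pow_left₀ 2 zero_le_one ?_
      rw [h3]
      nlinarith
    · rw [inner_smul_add_orthogonal hw]
      refine le_of_sq_le_sq ?_ ht.le
      rw [mul_pow, h3]
      have h4 : c * ‖x‖ ≤ s * t := (mul_le_mul_of_nonneg_left hx.le hc).trans h2
      have h5 : (c * ‖x‖) ^ 2 ≤ (s * t) ^ 2 := pow_le_pow_left₀ (by positivity) h4 2
      nlinarith
  rw [← (measurePreserving_smul_add_orthogonal hw).measure_preimage
    (measurableSet_capSector w c).nullMeasurableSet, Measure.volume_eq_prod,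
    Measure.prod_apply ((measurePreserving_smul_add_orthogonal hw).measurable
      (measurableSet_capSector w c))]
  have hdisj : Disjoint (Ioo 0 c) (Ioo c 1) :=
    Set.disjoint_left.2 fun t h1 h2 => lt_asymm h1.2 h2.1
  refine le_trans ?_ (setLIntegral_le_lintegral (Ioo 0 c ∪ Ioo c 1) _)
  rw [lintegral_union measurableSet_Ioo hdisj]
  refine add_le_add (setLIntegral_mono' measurableSet_Ioo fun t ht => measure_mono ?_)
    (setLIntegral_mono' measurableSet_Ioo fun t ht => measure_mono ?_)
  · have hc0 : 0 < c := ht.1.trans ht.2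
    refine hmem t _ ht.1 ?_ (le_of_eq (by field_simp))
    have : t ^ 2 + (s * (t / c)) ^ 2 = (t / c) ^ 2 := by
      field_simp
      linear_combination t ^ 2 * hcs
    rw [this]
    exact pow_le_one₀ (div_nonneg ht.1.le hc) ((div_le_one hc0).2 ht.2.le)
  · have hd : 0 < 1 - c := by linarith
    have ht1 : 0 < 1 - t := by linarith [ht.2]
    refine hmem t _ (hc.trans_lt ht.1) ?_ ?_
    · have : (s * ((1 - t) / (1 - c))) ^ 2 = (1 + c) * (1 - t) ^ 2 / (1 - c) := by
        rw [mul_pow, show s ^ 2 = (1 + c) * (1 - c) by linear_combination hcs]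
        field_simp
      rw [this, ← le_sub_iff_add_le', div_le_iff₀ hd]
      nlinarith [mul_pos ht1 (sub_pos.2 ht.1)]
    · rw [mul_left_comm]
      refine mul_le_mul_of_nonneg_left ?_ hs.le
      rw [mul_div_assoc', div_le_iff₀ hd]
      nlinarith [ht.1]

theorem lintegral_Ioo_ofReal_div_pow {c : ℝ} (hc : 0 ≤ c) (n : ℕ) :
    ∫⁻ t in Ioo 0 c, ENNReal.ofReal ((t / c) ^ n) = ENNReal.ofReal (c / (n + 1)) := by
  rcases hc.eq_or_lt with rfl | hc0
  · simp
  rw [restrict_Ioo_eq_restrict_Ioc, ← ofReal_integral_eq_lintegral_ofReal,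
    ← intervalIntegral.integral_of_le hc]
  · congr 1
    rw [intervalIntegral.integral_comp_div (fun x => x ^ n) hc0.ne', integral_pow]
    simp [hc0.ne', div_eq_mul_inv]
  · exact (Continuous.integrableOn_Icc (by fun_prop)).mono_set Ioc_subset_Icc_self
  · exact (ae_restrict_iff' measurableSet_Ioc).2 (.of_forall fun t ht => by
      have := ht.1.le
      simp only [Pi.zero_apply]
      positivity)

theorem lintegral_Ioo_ofReal_one_sub_div_pow {c : ℝ} (hc : c ≤ 1) (n : ℕ) :
    ∫⁻ t in Ioo c 1, ENNReal.ofReal (((1 - t) / (1 - c)) ^ n) =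
      ENNReal.ofReal ((1 - c) / (n + 1)) := by
  rw [← lintegral_Ioo_ofReal_div_pow (sub_nonneg.2 hc), ← lintegral_indicator measurableSet_Ioo,
    ← lintegral_indicator measurableSet_Ioo, ← lintegral_sub_left_eq_self _ 1]
  congr with t
  by_cases ht : t ∈ Ioo 0 (1 - c)
  · rw [indicator_of_mem ht, indicator_of_mem (mem_Ioo.2 ⟨by linarith [ht.2], by linarith [ht.1]⟩),
      sub_sub_cancel]
  · rw [indicator_of_notMem ht, indicator_of_notMem]
    exact fun h => ht ⟨by linarith [h.2], by linarith [h.1]⟩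

theorem le_volume_capSector {n : ℕ} [Fact (finrank ℝ E = n + 1)] {w : E} (hw : ‖w‖ = 1)
    {c s : ℝ} (hc : 0 ≤ c) (hs : 0 < s) (hcs : s ^ 2 + c ^ 2 = 1) :
    ENNReal.ofReal (s ^ n / (n + 1)) * volume (ball (0 : (ℝ ∙ w)ᗮ) 1) ≤
      volume (capSector w c) := by
  have hc1 : c < 1 := by nlinarith
  have hrank : finrank ℝ (ℝ ∙ w)ᗮ = n :=
    Submodule.finrank_orthogonal_span_singleton (by rw [← norm_ne_zero_iff, hw]; simp)
  have hball : ∀ ρ, 0 < ρ → volume (ball (0 : (ℝ ∙ w)ᗮ) (s * ρ)) =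
      ENNReal.ofReal (s ^ n) * volume (ball (0 : (ℝ ∙ w)ᗮ) 1) * ENNReal.ofReal (ρ ^ n) := by
    intro ρ hρ
    rw [Measure.addHaar_ball_of_pos _ _ (mul_pos hs hρ), hrank, mul_pow,
      ENNReal.ofReal_mul (by positivity)]
    ring
  refine le_trans (le_of_eq ?_) (lintegral_ball_radius_le_volume_capSector hw hc hs hcs)
  rw [setLIntegral_congr_fun measurableSet_Ioo
      fun t ht => hball (t / c) (div_pos ht.1 (ht.1.trans ht.2)),
    setLIntegral_congr_fun measurableSet_Ioo
      fun t ht => hball ((1 - t) / (1 - c)) (div_pos (sub_pos.2 ht.2) (sub_pos.2 hc1)),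
    lintegral_const_mul _ (by fun_prop), lintegral_const_mul _ (by fun_prop),
    lintegral_Ioo_ofReal_div_pow hc, lintegral_Ioo_ofReal_one_sub_div_pow hc1.le, ← mul_add,
    ← ENNReal.ofReal_add (by positivity) (div_nonneg (sub_nonneg.2 hc1.le) (by positivity)),
    mul_right_comm, ← ENNReal.ofReal_mul (by positivity)]
  congr 3
  ring

end Sector

theorem InnerProductSpace.volume_ball_one_eq_vball {E : Type*} [NormedAddCommGroup E]
    [InnerProductSpace ℝ E] [FiniteDimensional ℝ E] [MeasurableSpace E] [BorelSpace E]
    [Nontrivial E] : volume (ball (0 : E) 1) = ENNReal.ofReal (vball (finrank ℝ E)) := by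
  rw [InnerProductSpace.volume_ball, vball, Real.sqrt_eq_rpow,
    ← Real.rpow_mul_natCast Real.pi_nonneg]
  simp [div_eq_inv_mul]

theorem vball_pos (p : ℕ) : 0 < vball p :=
  div_pos (Real.rpow_pos_of_pos Real.pi_pos _) (Real.Gamma_pos_of_pos (by positivity))

/-- For `p ≥ 2`, a unit vector `w ∈ ℝ^p` and `θ ∈ [0, π/2]`, the area of the
spherical cap `{v ∈ S^{p−1} | arccos ⟪w, v⟫ ≤ θ}` relative to that of the whole sphere
(measured by the `(p−1)`-dimensional Hausdorff measure) is between
`(v_{p−1}/(p·v_p))·sin^{p−1} θ` and `(v_{p−1}/v_p)·sin^{p−1} θ`. -/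
theorem stmt_12 (p : ℕ) (hp : 2 ≤ p)
    (w : EuclideanSpace ℝ (Fin p)) (hw : ‖w‖ = 1)
    (θ : ℝ) (hθ : θ ∈ Set.Icc 0 (Real.pi / 2)) :
    ENNReal.ofReal (vball (p - 1) / (p * vball p) * Real.sin θ ^ (p - 1)) ≤
      μH[(p : ℝ) - 1] {v | v ∈ Metric.sphere (0 : EuclideanSpace ℝ (Fin p)) 1 ∧
          Real.arccos ⟪w, v⟫ ≤ θ} /
        μH[(p : ℝ) - 1] (Metric.sphere (0 : EuclideanSpace ℝ (Fin p)) 1) ∧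
    μH[(p : ℝ) - 1] {v | v ∈ Metric.sphere (0 : EuclideanSpace ℝ (Fin p)) 1 ∧
          Real.arccos ⟪w, v⟫ ≤ θ} /
        μH[(p : ℝ) - 1] (Metric.sphere (0 : EuclideanSpace ℝ (Fin p)) 1) ≤
      ENNReal.ofReal (vball (p - 1) / vball p * Real.sin θ ^ (p - 1)) := by
  obtain ⟨n, rfl⟩ : ∃ n, p = n + 1 := ⟨p - 1, by omega⟩
  have hn : n ≠ 0 := by omega
  have hfin : finrank ℝ (EuclideanSpace ℝ (Fin (n + 1))) = n + 1 := by simp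
  have : Fact (finrank ℝ (EuclideanSpace ℝ (Fin (n + 1))) = n + 1) := ⟨hfin⟩
  have hrank : finrank ℝ (ℝ ∙ w)ᗮ = n :=
    Submodule.finrank_orthogonal_span_singleton (by rw [← norm_ne_zero_iff, hw]; simp)
  have : Nontrivial (ℝ ∙ w)ᗮ := Module.nontrivial_of_finrank_pos (R := ℝ) (by omega)
  have hc : 0 ≤ Real.cos θ :=
    Real.cos_nonneg_of_mem_Icc ⟨by linarith [hθ.1, Real.pi_pos], hθ.2⟩
  have hs : 0 ≤ Real.sin θ := Real.sin_nonneg_of_mem_Icc ⟨hθ.1, by linarith [hθ.2, Real.pi_pos]⟩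
  have hcs := Real.sin_sq_add_cos_sq θ
  have hv := vball_pos (n + 1)
  have hball : volume (ball (0 : (ℝ ∙ w)ᗮ) 1) = ENNReal.ofReal (vball n) := by
    rw [InnerProductSpace.volume_ball_one_eq_vball, hrank]
  have hmeas : MeasurableSet (sphere (0 : EuclideanSpace ℝ (Fin (n + 1))) 1 ∩
      {v | Real.cos θ ≤ ⟪w, v⟫}) :=
    isClosed_sphere.measurableSet.inter (isClosed_le (by fun_prop) (by fun_prop)).measurableSet
  rw [sphericalCap_eq hw hθ, show ((n + 1 : ℕ) : ℝ) - 1 = n by simp,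
    hausdorffMeasure_sphere_div_eq inter_subset_left hmeas, Ioo_smul_sphericalCap,
    InnerProductSpace.volume_ball_one_eq_vball, hfin, Nat.add_sub_cancel]
  constructor
  · rcases hs.eq_or_lt with hs0 | hs0
    · simp [← hs0, hn]
    · refine (ENNReal.le_div_iff_mul_le (.inl (by simpa using hv)) (.inl (by simp))).2 ?_
      refine le_trans (le_of_eq ?_) (le_volume_capSector (n := n) hw hc hs0 hcs)
      rw [hball, ← ENNReal.ofReal_mul' hv.le, ← ENNReal.ofReal_mul' (vball_pos n).le]
      congr 1
      push_cast
      field_simp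
  · refine ENNReal.div_le_of_le_mul ((volume_capSector_le hw hc hs hcs).trans (le_of_eq ?_))
    rw [Measure.addHaar_closedBall _ _ hs, hrank, hball, ← ENNReal.ofReal_mul' hv.le,
      ← ENNReal.ofReal_mul' (vball_pos n).le]
    congr 1
    field_simp
end
end

section
/- Let A0 be a D × s0 matrix whose columns are s0 linearly independent unit vectors in ℝ^D spanning a subspace S0. Then the set of dual points of A0, i.e., the set of extreme points of K0° = {v ∈ S0 : ‖A0ᵀ v‖_∞ ≤ 1}, is exactly {A0 (A0ᵀ A0)^{−1} u : u ∈ {−1, 1}^{s0}}, and this set has exactly 2^{s0} distinct elements. -/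
open Matrix

noncomputable section

/-- An injective linear map carries extreme points to extreme points. -/
theorem image_extremePoints_of_injective {E F : Type*} [AddCommGroup E] [Module ℝ E]
    [AddCommGroup F] [Module ℝ F] (f : E →ₗ[ℝ] F) (hf : Function.Injective f) (s : Set E) :
    f '' Set.extremePoints ℝ s = Set.extremePoints ℝ (f '' s) := by
  have himg : ∀ x y, f '' openSegment ℝ x y = openSegment ℝ (f x) (f y) :=
    image_openSegment _ f.toAffineMap
  ext b
  constructor
  · rintro ⟨a, ha, rfl⟩
    rw [mem_extremePoints_iff_left] at ha ⊢
    refine ⟨Set.mem_image_of_mem f ha.1, ?_⟩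
    rintro _ ⟨x, hx, rfl⟩ _ ⟨y, hy, rfl⟩ hxy
    rw [← himg, hf.mem_set_image] at hxy
    rw [ha.2 x hx y hy hxy]
  · intro hb
    rw [mem_extremePoints_iff_left] at hb
    obtain ⟨⟨a, ha, rfl⟩, hb⟩ := hb
    refine ⟨a, mem_extremePoints_iff_left.2 ⟨ha, fun x hx y hy hxy => hf ?_⟩, rfl⟩
    exact hb (f x) (Set.mem_image_of_mem f hx) (f y) (Set.mem_image_of_mem f hy)
      (himg x y ▸ Set.mem_image_of_mem f hxy)

theorem isUnit_transpose_mul_self {m n : Type*} [Fintype m] [Fintype n] [DecidableEq n]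
    (A : Matrix m n ℝ) (hA : LinearIndependent ℝ A.col) : IsUnit (Aᵀ * A) := by
  have hinj : Function.Injective A.mulVecLin := Matrix.mulVec_injective_iff.2 hA
  rw [← Matrix.mulVec_injective_iff_isUnit]
  change Function.Injective (Aᵀ * A).mulVecLin
  rw [← LinearMap.ker_eq_bot, Matrix.ker_mulVecLin_transpose_mul_self]
  exact LinearMap.ker_eq_bot.2 hinj

/-- The extreme points of the cube `[-1, 1]^ι` are the sign vectors. -/
theorem extremePoints_pi_Icc_neg_one_one (ι : Type*) :
    Set.extremePoints ℝ (Set.univ.pi fun _ : ι => Set.Icc (-1 : ℝ) 1) =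
      {u | ∀ i, u i = 1 ∨ u i = -1} := by
  rw [extremePoints_pi]
  ext u
  simp [Set.extremePoints_Icc, or_comm]

theorem ncard_sign_vectors (ι : Type*) [Fintype ι] :
    {u : ι → ℝ | ∀ i, u i = 1 ∨ u i = -1}.ncard = 2 ^ Fintype.card ι := by
  classical
  have h : {u : ι → ℝ | ∀ i, u i = 1 ∨ u i = -1} =
      (Fintype.piFinset fun _ : ι => ({1, -1} : Finset ℝ) : Set (ι → ℝ)) := by
    ext u
    simp
  have hcard : ({1, -1} : Finset ℝ).card = 2 := Finset.card_pair (by norm_num)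
  rw [h, Set.ncard_coe_finset, Fintype.card_piFinset, Finset.prod_const, hcard, Finset.card_univ]

/-- Let `A` be a `D × s0` matrix whose columns are `s0` linearly independent
unit vectors of `ℝ^D` spanning the subspace `S0 = range A`. Then the set of dual points of
`A`, i.e. the set of extreme points of `K0° = {v ∈ S0 | ‖Aᵀ v‖_∞ ≤ 1}`, is exactly
`{A (AᵀA)⁻¹ u : u ∈ {−1, 1}^{s0}}`, and it has exactly `2^{s0}` distinct elements. -/
theorem stmt_17 {D s0 : ℕ}
    (A : Matrix (Fin D) (Fin s0) ℝ)
    (hindep : LinearIndependent ℝ (fun j : Fin s0 => Aᵀ j))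
    (hunit : ∀ j : Fin s0, Aᵀ j ⬝ᵥ Aᵀ j = 1)
    (S0 : Submodule ℝ (Fin D → ℝ))
    (hS0 : S0 = Submodule.span ℝ (Set.range fun j : Fin s0 => Aᵀ j))
    (K : Set (Fin D → ℝ))
    (hK : K = {v | v ∈ S0 ∧ ∀ j : Fin s0, |(Aᵀ *ᵥ v) j| ≤ 1}) :
    Set.extremePoints ℝ K =
      (fun u => A *ᵥ ((Aᵀ * A)⁻¹ *ᵥ u)) '' {u : Fin s0 → ℝ | ∀ i, u i = 1 ∨ u i = -1} ∧
    (Set.extremePoints ℝ K).ncard = 2 ^ s0 := by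
  have hcol : LinearIndependent ℝ A.col := hindep
  have hdet : IsUnit (Aᵀ * A).det :=
    (Matrix.isUnit_iff_isUnit_det _).1 (isUnit_transpose_mul_self A hcol)
  set f : (Fin s0 → ℝ) →ₗ[ℝ] (Fin D → ℝ) := A.mulVecLin ∘ₗ ((Aᵀ * A)⁻¹).mulVecLin with hf
  have hleft : ∀ u, Aᵀ *ᵥ f u = u := fun u => by
    simp [hf, Matrix.mulVec_mulVec, ← Matrix.mul_assoc, Matrix.mul_nonsing_inv _ hdet]
  have hinj : Function.Injective f := Function.LeftInverse.injective hleft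
  have hspan : S0 = LinearMap.range A.mulVecLin := by
    rw [hS0, Matrix.range_mulVecLin]
    rfl
  have hright : ∀ v ∈ S0, f (Aᵀ *ᵥ v) = v := by
    rw [hspan]
    rintro _ ⟨x, rfl⟩
    simp [hf, Matrix.mulVec_mulVec, Matrix.nonsing_inv_mul _ hdet]
  have hKf : K = f '' Set.univ.pi fun _ => Set.Icc (-1 : ℝ) 1 := by
    rw [hK]
    ext v
    constructor
    · rintro ⟨hv, hb⟩
      exact ⟨Aᵀ *ᵥ v, fun j _ => abs_le.1 (hb j), hright v hv⟩
    · rintro ⟨u, hu, rfl⟩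
      refine ⟨hspan ▸ ⟨_, rfl⟩, fun j => ?_⟩
      rw [hleft]
      exact abs_le.2 (hu j trivial)
  have hext : Set.extremePoints ℝ K = f '' {u | ∀ i, u i = 1 ∨ u i = -1} := by
    rw [hKf, ← image_extremePoints_of_injective f hinj, extremePoints_pi_Icc_neg_one_one]
  refine ⟨hext, ?_⟩
  rw [hext, Set.ncard_image_of_injective _ hinj, ncard_sign_vectors, Fintype.card_fin]
end
end

section
/- For every integer p ≥ 1, the ratio of unit-ball volumes satisfies (p + 1)/√(2π(p + 2)) ≤ v_{p−1}/v_p ≤ √((p + 1)/(2π)), where v_p = π^{p/2}/Γ(p/2 + 1) is the Lebesgue volume of the unit ball in ℝ^p (and v_0 = 1). -/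
noncomputable section

/-- Midpoint log-convexity of the Gamma function on an interval of length one, combined with the
functional equation. -/
lemma Gamma_add_half_sq_le {x : ℝ} (hx : 0 < x) :
    Real.Gamma (x + 1 / 2) ^ 2 ≤ x * Real.Gamma x ^ 2 := by
  have hG := Real.Gamma_pos_of_pos hx
  have h := Real.Gamma_mul_add_mul_le_rpow_Gamma_mul_rpow_Gamma hx (add_pos hx one_pos)
    (a := 1 / 2) (b := 1 / 2) (by norm_num) (by norm_num) (by norm_num)
  rw [show (1 / 2 : ℝ) * x + 1 / 2 * (x + 1) = x + 1 / 2 by ring, Real.Gamma_add_one hx.ne',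
    ← Real.mul_rpow hG.le (by positivity), ← Real.sqrt_eq_rpow] at h
  have hB := Real.Gamma_pos_of_pos (show 0 < x + 1 / 2 by linarith)
  have := (Real.le_sqrt hB.le (by positivity)).1 h
  linarith

/-- The ratio of volumes of unit balls in consecutive dimensions as a ratio of Gamma values. -/
lemma vball_div_vball_succ (q : ℕ) :
    vball q / vball (q + 1) =
      Real.Gamma ((q : ℝ) / 2 + 1 + 1 / 2) / (Real.Gamma ((q : ℝ) / 2 + 1) * √Real.pi) := by
  have hA := Real.Gamma_pos_of_pos (show (0 : ℝ) < (q : ℝ) / 2 + 1 by positivity)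
  have hB := Real.Gamma_pos_of_pos (show (0 : ℝ) < (q : ℝ) / 2 + 1 + 1 / 2 by positivity)
  have hP := Real.rpow_pos_of_pos Real.pi_pos ((q : ℝ) / 2)
  have hS := Real.sqrt_pos.2 Real.pi_pos
  unfold vball
  rw [show ((q + 1 : ℕ) : ℝ) / 2 + 1 = (q : ℝ) / 2 + 1 + 1 / 2 by push_cast; ring,
    show ((q + 1 : ℕ) : ℝ) / 2 = (q : ℝ) / 2 + 1 / 2 by push_cast; ring,
    Real.rpow_add Real.pi_pos, ← Real.sqrt_eq_rpow]
  field_simp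

/-- For every integer `p ≥ 1`, the ratio of unit-ball volumes satisfies
`(p + 1)/√(2π(p + 2)) ≤ v_{p−1}/v_p ≤ √((p + 1)/(2π))`. -/
theorem stmt_19 (p : ℕ) (hp : 1 ≤ p) :
    ((p : ℝ) + 1) / Real.sqrt (2 * Real.pi * ((p : ℝ) + 2)) ≤ vball (p - 1) / vball p ∧
    vball (p - 1) / vball p ≤ Real.sqrt (((p : ℝ) + 1) / (2 * Real.pi)) := by
  obtain ⟨q, rfl⟩ := Nat.exists_eq_add_of_le' hp
  rw [Nat.add_sub_cancel, vball_div_vball_succ]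
  push_cast
  set x : ℝ := (q : ℝ) / 2 + 1 with hx
  have hx0 : 0 < x := by positivity
  have hq : (q : ℝ) = 2 * x - 2 := by rw [hx]; ring
  have upper := Gamma_add_half_sq_le hx0
  have lower := Gamma_add_half_sq_le (show 0 < x + 1 / 2 by linarith)
  rw [show x + 1 / 2 + 1 / 2 = x + 1 by ring, Real.Gamma_add_one hx0.ne'] at lower
  have hA := Real.Gamma_pos_of_pos hx0
  have hB := Real.Gamma_pos_of_pos (show 0 < x + 1 / 2 by linarith)
  have hpi := Real.pi_pos
  have hS := Real.sqrt_pos.2 hpi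
  rw [hq]
  constructor
  · have hy : 0 < 2 * Real.pi * (2 * x - 2 + 1 + 2) := by
      have : 0 < 2 * x - 2 + 1 + 2 := by linarith
      positivity
    have hT := Real.sqrt_pos.2 hy
    refine (pow_le_pow_iff_left₀ (div_nonneg (by linarith) hT.le) (by positivity) two_ne_zero).1 ?_
    rw [div_pow, div_pow, mul_pow, Real.sq_sqrt hy.le, Real.sq_sqrt hpi.le,
      div_le_div_iff₀ hy (by positivity)]
    nlinarith [mul_le_mul_of_nonneg_left lower hpi.le]
  · refine Real.le_sqrt_of_sq_le ?_
    rw [div_pow, mul_pow, Real.sq_sqrt hpi.le, div_le_div_iff₀ (by positivity) (by positivity)]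
    nlinarith [mul_le_mul_of_nonneg_left upper hpi.le]
end
end
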